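/- arXiv:2309.09757 — 3 statements merged into one kernel-verified Lean document; each statement's English description precedes it below -/
import Mathlib

section
/- Let U ⊆ ℝⁿ be open, p₀ ∈ U, let X₁,…,X_r be linearly independent real-valued smooth vector fields on U, and let 𝒟 be the C^∞(U)-module of smooth vector fields generated by X₁,…,X_r. Then for any germs f, g of complex-valued smooth functions at p₀, the vanishing orders satisfy ν_𝒟(fg)(p₀) = ν_𝒟(f)(p₀) + ν_𝒟(g)(p₀) (with the convention that the sum is ∞ if either term is ∞). -/
open Topology

/-- ℝⁿ as a Pi type. -/
abbrev Rn (n : ℕ) := Fin n → ℝ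

/-- The action of a vector field `Y` on a function `f` : `(Y f)(x) = df_x(Y(x))`. -/
noncomputable def vfApply {n : ℕ} {E : Type*} [NormedAddCommGroup E] [NormedSpace ℝ E]
    (Y : Rn n → Rn n) (f : Rn n → E) : Rn n → E :=
  fun x => fderiv ℝ f x (Y x)

/-- `Y` belongs to the `C^∞(U)`-module `𝒟` of vector fields generated by `X₁, …, X_r`. -/
def InModule {n r : ℕ} (U : Set (Rn n)) (X : Fin r → Rn n → Rn n) (Y : Rn n → Rn n) : Prop :=
  ∃ a : Fin r → Rn n → ℝ, (∀ j, ContDiffOn ℝ (⊤ : ℕ∞) (a j) U) ∧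
    ∀ x ∈ U, Y x = ∑ j, a j x • X j x

/-- The vanishing order `ν_𝒟(f)(p)`: the smallest `m` such that some iterated derivative
`Y_m(⋯(Y_1 f)⋯)(p) ≠ 0` with all `Y_i ∈ 𝒟`; `⊤` if no such `m` exists. -/
noncomputable def vanishOrder {n r : ℕ} {E : Type*} [NormedAddCommGroup E] [NormedSpace ℝ E]
    (U : Set (Rn n)) (X : Fin r → Rn n → Rn n) (f : Rn n → E) (p : Rn n) : ℕ∞ :=
  sInf {m : ℕ∞ | ∃ Ys : List (Rn n → Rn n), (Ys.length : ℕ∞) = m ∧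
    (∀ Y ∈ Ys, InModule U X Y) ∧ (Ys.foldl (fun g Y => vfApply Y g) f) p ≠ 0}

/-- All ways of splitting a word into a pair of complementary subwords, with multiplicity. -/
def unshuffles {α : Type*} : List α → List (List α × List α)
  | [] => [([], [])]
  | j :: w => (unshuffles w).map (fun q => (j :: q.1, q.2)) ++
      (unshuffles w).map (fun q => (q.1, j :: q.2))

/-- The shuffle product of two functions on words. -/
def shuffleMul {α R : Type*} [Semiring R] (F G : List α → R) (w : List α) : R :=
  ((unshuffles w).map fun q => F q.1 * G q.2).sum

/-- The least length of a word on which `F` does not vanish. -/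
noncomputable def wordOrder {α R : Type*} [Zero R] (F : List α → R) : ℕ∞ :=
  sInf {m : ℕ∞ | ∃ w : List α, (w.length : ℕ∞) = m ∧ F w ≠ 0}

section Words

variable {α R : Type*}

theorem mem_unshuffles_cons {j : α} {w u v : List α} :
    (u, v) ∈ unshuffles (j :: w) ↔
      (∃ u', (u', v) ∈ unshuffles w ∧ u = j :: u') ∨
        (∃ v', (u, v') ∈ unshuffles w ∧ v = j :: v') := by
  simp only [unshuffles, List.mem_append, List.mem_map, Prod.mk.injEq, Prod.exists]
  grind

theorem length_of_mem_unshuffles {w u v : List α} (h : (u, v) ∈ unshuffles w) :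
    w.length = u.length + v.length := by
  induction w generalizing u v with
  | nil => simp_all [unshuffles]
  | cons j w ih =>
    rcases mem_unshuffles_cons.1 h with ⟨u', h', rfl⟩ | ⟨v', h', rfl⟩ <;>
      simp [ih h'] <;> omega

theorem mem_unshuffles_append (u v : List α) : (u, v) ∈ unshuffles (u ++ v) := by
  induction u with
  | nil =>
    induction v with
    | nil => simp [unshuffles]
    | cons j v ih => exact mem_unshuffles_cons.2 (Or.inr ⟨v, ih, rfl⟩)
  | cons j u ih => exact mem_unshuffles_cons.2 (Or.inl ⟨u, ih, rfl⟩)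

theorem cons_le_cons_iff_lex [LinearOrder α] {a b : α} {l m : List α} :
    a :: l ≤ b :: m ↔ a < b ∨ a = b ∧ l ≤ m := by
  rw [le_iff_lt_or_eq, le_iff_lt_or_eq]
  have h : a :: l < b :: m ↔ a < b ∨ a = b ∧ l < m := List.cons_lt_cons_iff
  rw [h, List.cons.injEq]
  tauto

/-- Replacing both factors of a shuffle by lexicographically larger words of the same lengths
yields a larger shuffle, strictly so if one of the factors changes. -/
theorem exists_le_of_mem_unshuffles [LinearOrder α] {w u v u' v' : List α}
    (h : (u, v) ∈ unshuffles w) (hu : u ≤ u') (hv : v ≤ v')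
    (hul : u.length = u'.length) (hvl : v.length = v'.length) :
    ∃ w', (u', v') ∈ unshuffles w' ∧ w ≤ w' ∧ (w = w' → u = u' ∧ v = v') := by
  induction w generalizing u v u' v' with
  | nil =>
    obtain ⟨rfl, rfl⟩ : u = [] ∧ v = [] := by simpa [unshuffles] using h
    obtain rfl := List.eq_nil_of_length_eq_zero hul.symm
    obtain rfl := List.eq_nil_of_length_eq_zero hvl.symm
    exact ⟨[], h, le_rfl, fun _ => ⟨rfl, rfl⟩⟩
  | cons j w ih =>
    rcases mem_unshuffles_cons.1 h with ⟨u₁, h', rfl⟩ | ⟨v₁, h', rfl⟩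
    · obtain _ | ⟨k, u₁'⟩ := u'
      · simp at hul
      rcases cons_le_cons_iff_lex.1 hu with hjk | ⟨rfl, hu₁⟩
      · exact ⟨k :: (u₁' ++ v'),
          mem_unshuffles_cons.2 (Or.inl ⟨_, mem_unshuffles_append _ _, rfl⟩),
          cons_le_cons_iff_lex.2 (Or.inl hjk), fun e => absurd (List.cons.inj e).1 hjk.ne⟩
      · obtain ⟨w', hw', hle, heq⟩ := ih h' hu₁ hv (by simpa using hul) hvl
        exact ⟨j :: w', mem_unshuffles_cons.2 (Or.inl ⟨_, hw', rfl⟩),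
          cons_le_cons_iff_lex.2 (Or.inr ⟨rfl, hle⟩), fun e => by
            simpa using heq (List.cons.inj e).2⟩
    · obtain _ | ⟨k, v₁'⟩ := v'
      · simp at hvl
      rcases cons_le_cons_iff_lex.1 hv with hjk | ⟨rfl, hv₁⟩
      · exact ⟨k :: (u' ++ v₁'),
          mem_unshuffles_cons.2 (Or.inr ⟨_, mem_unshuffles_append _ _, rfl⟩),
          cons_le_cons_iff_lex.2 (Or.inl hjk), fun e => absurd (List.cons.inj e).1 hjk.ne⟩
      · obtain ⟨w', hw', hle, heq⟩ := ih h' hu hv₁ hul (by simpa using hvl)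
        exact ⟨j :: w', mem_unshuffles_cons.2 (Or.inr ⟨_, hw', rfl⟩),
          cons_le_cons_iff_lex.2 (Or.inr ⟨rfl, hle⟩), fun e => by
            simpa using heq (List.cons.inj e).2⟩

theorem exists_mem_unshuffles_of_shuffleMul_ne_zero [Semiring R] {F G : List α → R} {w : List α}
    (h : shuffleMul F G w ≠ 0) : ∃ u v, (u, v) ∈ unshuffles w ∧ F u ≠ 0 ∧ G v ≠ 0 := by
  obtain ⟨x, hx, hx0⟩ := List.exists_mem_ne_zero_of_sum_ne_zero h
  obtain ⟨⟨u, v⟩, hq, rfl⟩ := List.mem_map.1 hx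
  exact ⟨u, v, hq, left_ne_zero_of_mul hx0, right_ne_zero_of_mul hx0⟩

theorem list_sum_ne_zero_of_forall_eq_zero_or_eq [Semiring R] [NoZeroDivisors R] [CharZero R]
    {l : List R} {c : R} (hc : c ≠ 0) (h : ∀ x ∈ l, x = 0 ∨ x = c) (hmem : c ∈ l) :
    l.sum ≠ 0 := by
  classical
  have key : l.sum = l.count c * c := by
    clear hmem
    induction l with
    | nil => simp
    | cons x l ih =>
      rw [List.sum_cons, ih fun y hy => h y (List.mem_cons_of_mem _ hy)]
      rcases h x List.mem_cons_self with rfl | rfl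
      · simp [List.count_cons_of_ne hc.symm]
      · simp [add_mul, add_comm]
  rw [key]
  exact mul_ne_zero (Nat.cast_ne_zero.2 (List.count_pos_iff.2 hmem).ne') hc

theorem wordOrder_le [Zero R] {F : List α → R} {w : List α} (h : F w ≠ 0) :
    wordOrder F ≤ w.length :=
  sInf_le ⟨w, rfl, h⟩

theorem exists_length_eq_wordOrder [Zero R] {F : List α → R} (h : wordOrder F ≠ ⊤) :
    ∃ w : List α, (w.length : ℕ∞) = wordOrder F ∧ F w ≠ 0 := by
  refine csInf_mem (s := {m : ℕ∞ | ∃ w : List α, (w.length : ℕ∞) = m ∧ F w ≠ 0}) ?_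
  by_contra! he
  exact h (by rw [wordOrder, he, sInf_empty])

theorem exists_max_of_length_eq [LinearOrder α] [Finite α] {P : List α → Prop} {m : ℕ}
    (hlen : ∀ w, P w → w.length = m) (hne : ∃ w, P w) : ∃ w, P w ∧ ∀ w', P w' → w' ≤ w := by
  have hfin : {w | P w}.Finite := (List.finite_length_eq α m).subset hlen
  obtain ⟨w, hw, hmax⟩ := Set.exists_max_image {w | P w} id hfin hne
  exact ⟨w, hw, hmax⟩

/-- The order is additive under shuffle products over a domain of characteristic zero. -/
theorem wordOrder_shuffleMul [LinearOrder α] [Finite α] [Semiring R] [NoZeroDivisors R]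
    [CharZero R] (F G : List α → R) :
    wordOrder (shuffleMul F G) = wordOrder F + wordOrder G := by
  apply le_antisymm
  · by_cases hF : wordOrder F = ⊤
    · simp [hF]
    by_cases hG : wordOrder G = ⊤
    · simp [hG]
    obtain ⟨u₁, hu₁, hFu₁⟩ := exists_length_eq_wordOrder hF
    obtain ⟨v₁, hv₁, hGv₁⟩ := exists_length_eq_wordOrder hG
    obtain ⟨u, ⟨hul, hFu⟩, humax⟩ := exists_max_of_length_eq
      (P := fun u => u.length = u₁.length ∧ F u ≠ 0) (fun _ h => h.1) ⟨u₁, rfl, hFu₁⟩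
    obtain ⟨v, ⟨hvl, hGv⟩, hvmax⟩ := exists_max_of_length_eq
      (P := fun v => v.length = v₁.length ∧ G v ≠ 0) (fun _ h => h.1) ⟨v₁, rfl, hGv₁⟩
    obtain ⟨w, hw, hwmax⟩ := exists_max_of_length_eq (P := fun w => (u, v) ∈ unshuffles w)
      (fun _ h => length_of_mem_unshuffles h) ⟨_, mem_unshuffles_append u v⟩
    have hwl := length_of_mem_unshuffles hw
    rw [← hu₁, ← hv₁, ← hul, ← hvl, ← Nat.cast_add, ← hwl]
    refine wordOrder_le (list_sum_ne_zero_of_forall_eq_zero_or_eq (mul_ne_zero hFu hGv) ?_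
      (List.mem_map.2 ⟨_, hw, rfl⟩))
    intro x hx
    obtain ⟨⟨s, t⟩, hst, rfl⟩ := List.mem_map.1 hx
    refine or_iff_not_imp_left.2 fun h0 => ?_
    have hFs := left_ne_zero_of_mul h0
    have hGt := right_ne_zero_of_mul h0
    have hstl := length_of_mem_unshuffles hst
    have h₁ : u₁.length ≤ s.length := by exact_mod_cast hu₁ ▸ wordOrder_le hFs
    have h₂ : v₁.length ≤ t.length := by exact_mod_cast hv₁ ▸ wordOrder_le hGt
    have hsl : s.length = u₁.length := by omega
    have htl : t.length = v₁.length := by omega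
    obtain ⟨w', hw', hle, heq⟩ := exists_le_of_mem_unshuffles hst (humax s ⟨hsl, hFs⟩)
      (hvmax t ⟨htl, hGt⟩) (hsl.trans hul.symm) (htl.trans hvl.symm)
    obtain ⟨rfl, rfl⟩ := heq (le_antisymm hle (hwmax w' hw'))
    rfl
  · refine le_sInf ?_
    rintro m ⟨w, rfl, hw⟩
    obtain ⟨u, v, huv, hu, hv⟩ := exists_mem_unshuffles_of_shuffleMul_ne_zero hw
    rw [length_of_mem_unshuffles huv, Nat.cast_add]
    exact add_le_add (wordOrder_le hu) (wordOrder_le hv)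

end Words

section VectorFields

variable {n r : ℕ} {U : Set (Rn n)} {X : Fin r → Rn n → Rn n} {f g : Rn n → ℂ}

/-- The iterated derivative of `f` along the fields `X j`, for `j` running through a word. -/
noncomputable def wordDeriv (X : Fin r → Rn n → Rn n) (f : Rn n → ℂ) (w : List (Fin r)) :
    Rn n → ℂ :=
  w.foldl (fun g j => vfApply (X j) g) f

theorem vfApply_congr (hU : IsOpen U) (h : Set.EqOn f g U) (Y : Rn n → Rn n) :
    Set.EqOn (vfApply Y f) (vfApply Y g) U := fun x hx => by
  have : f =ᶠ[𝓝 x] g := Filter.eventuallyEq_of_mem (hU.mem_nhds hx) h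
  simp [vfApply, this.fderiv_eq]

theorem contDiffOn_vfApply (hU : IsOpen U) {Y : Rn n → Rn n} (hY : ContDiffOn ℝ (⊤ : ℕ∞) Y U)
    (hf : ContDiffOn ℝ (⊤ : ℕ∞) f U) : ContDiffOn ℝ (⊤ : ℕ∞) (vfApply Y f) U :=
  (hf.fderiv_of_isOpen hU (by simp)).clm_apply hY

theorem differentiableAt_of_contDiffOn (hU : IsOpen U) (hf : ContDiffOn ℝ (⊤ : ℕ∞) f U)
    {x : Rn n} (hx : x ∈ U) : DifferentiableAt ℝ f x :=
  (hf.contDiffAt (hU.mem_nhds hx)).differentiableAt (by simp)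

theorem foldl_vfApply_congr (hU : IsOpen U) (h : Set.EqOn f g U) (Ys : List (Rn n → Rn n)) :
    Set.EqOn (Ys.foldl (fun g Y => vfApply Y g) f) (Ys.foldl (fun g Y => vfApply Y g) g) U := by
  induction Ys generalizing f g with
  | nil => exact h
  | cons Y Ys ih => exact ih (vfApply_congr hU h Y)

theorem wordDeriv_eq_foldl (w : List (Fin r)) :
    wordDeriv X f w = (w.map X).foldl (fun g Y => vfApply Y g) f := by
  rw [wordDeriv, List.foldl_map]

theorem wordDeriv_congr (hU : IsOpen U) (h : Set.EqOn f g U) (w : List (Fin r)) :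
    Set.EqOn (wordDeriv X f w) (wordDeriv X g w) U := by
  simpa only [wordDeriv_eq_foldl] using foldl_vfApply_congr hU h (w.map X)

theorem wordDeriv_zero (w : List (Fin r)) : wordDeriv X 0 w = 0 := by
  induction w with
  | nil => rfl
  | cons j w ih =>
    have : vfApply (X j) (0 : Rn n → ℂ) = 0 := by ext x; simp [vfApply]
    simpa [wordDeriv, this] using ih

theorem wordDeriv_add (hU : IsOpen U) (hX : ∀ j, ContDiffOn ℝ (⊤ : ℕ∞) (X j) U)
    (hf : ContDiffOn ℝ (⊤ : ℕ∞) f U) (hg : ContDiffOn ℝ (⊤ : ℕ∞) g U) (w : List (Fin r)) :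
    Set.EqOn (wordDeriv X (f + g) w) (wordDeriv X f w + wordDeriv X g w) U := by
  induction w generalizing f g with
  | nil => exact fun _ _ => rfl
  | cons j w ih =>
    have h : Set.EqOn (vfApply (X j) (f + g)) (vfApply (X j) f + vfApply (X j) g) U :=
      fun x hx => by
        simp [vfApply, fderiv_add (differentiableAt_of_contDiffOn hU hf hx)
          (differentiableAt_of_contDiffOn hU hg hx)]
    exact (wordDeriv_congr hU h w).trans
      (ih (contDiffOn_vfApply hU (hX j) hf) (contDiffOn_vfApply hU (hX j) hg))

theorem wordDeriv_sum (hU : IsOpen U) (hX : ∀ j, ContDiffOn ℝ (⊤ : ℕ∞) (X j) U) {ι : Type*}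
    (s : Finset ι) {F : ι → Rn n → ℂ} (hF : ∀ i, ContDiffOn ℝ (⊤ : ℕ∞) (F i) U)
    (w : List (Fin r)) :
    Set.EqOn (wordDeriv X (∑ i ∈ s, F i) w) (∑ i ∈ s, wordDeriv X (F i) w) U := by
  classical
  induction s using Finset.induction_on with
  | empty => simp [wordDeriv_zero, Set.EqOn]
  | insert i s hi ih =>
    rw [Finset.sum_insert hi, Finset.sum_insert hi]
    intro x hx
    have hs : ContDiffOn ℝ (⊤ : ℕ∞) (∑ i ∈ s, F i) U := by
      simpa [Finset.sum_fn] using ContDiffOn.sum (s := s) fun i _ => hF i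
    rw [wordDeriv_add hU hX (hF i) hs w hx, Pi.add_apply, Pi.add_apply, ih hx]

/-- The Leibniz rule for iterated derivatives. -/
theorem wordDeriv_mul (hU : IsOpen U) (hX : ∀ j, ContDiffOn ℝ (⊤ : ℕ∞) (X j) U)
    (hf : ContDiffOn ℝ (⊤ : ℕ∞) f U) (hg : ContDiffOn ℝ (⊤ : ℕ∞) g U) (w : List (Fin r))
    {x : Rn n} (hx : x ∈ U) :
    wordDeriv X (f * g) w x =
      shuffleMul (fun u => wordDeriv X f u x) (fun v => wordDeriv X g v x) w := by
  induction w generalizing f g with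
  | nil => simp [shuffleMul, unshuffles, wordDeriv]
  | cons j w ih =>
    have hf' := contDiffOn_vfApply hU (hX j) hf
    have hg' := contDiffOn_vfApply hU (hX j) hg
    have h : Set.EqOn (vfApply (X j) (f * g)) (vfApply (X j) f * g + f * vfApply (X j) g) U :=
      fun x hx => by
        simp [vfApply, fderiv_mul (differentiableAt_of_contDiffOn hU hf hx)
          (differentiableAt_of_contDiffOn hU hg hx)]
        ring
    have h₁ := wordDeriv_congr (X := X) hU h w hx
    rw [wordDeriv_add hU hX (f := vfApply (X j) f * g) (g := f * vfApply (X j) g)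
      (hf'.mul hg) (hf.mul hg') w hx, Pi.add_apply, ih hf' hg, ih hf hg']
      at h₁
    refine h₁.trans ?_
    simp [shuffleMul, unshuffles, wordDeriv, Function.comp_def]

theorem inModule_generator (j : Fin r) : InModule U X (X j) := by
  classical
  refine ⟨fun i _ => if i = j then 1 else 0, fun i => contDiffOn_const, fun x _ => ?_⟩
  simp

theorem exists_wordDeriv_ne_zero (hU : IsOpen U) (hX : ∀ j, ContDiffOn ℝ (⊤ : ℕ∞) (X j) U)
    {x : Rn n} (hx : x ∈ U) {Ys : List (Rn n → Rn n)} (hYs : ∀ Y ∈ Ys, InModule U X Y)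
    (hf : ContDiffOn ℝ (⊤ : ℕ∞) f U) (h : Ys.foldl (fun g Y => vfApply Y g) f x ≠ 0) :
    ∃ w : List (Fin r), w.length ≤ Ys.length ∧ wordDeriv X f w x ≠ 0 := by
  induction Ys generalizing f with
  | nil => exact ⟨[], le_rfl, h⟩
  | cons Y Ys ih =>
    obtain ⟨a, ha, hY⟩ := hYs Y List.mem_cons_self
    have ha' : ∀ j, ContDiffOn ℝ (⊤ : ℕ∞) (fun y => (a j y : ℂ)) U := fun j =>
      Complex.ofRealCLM.contDiff.comp_contDiffOn (ha j)
    have hXf := fun j => contDiffOn_vfApply hU (hX j) hf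
    have hYf : Set.EqOn (vfApply Y f) (∑ j, (fun y => (a j y : ℂ)) * vfApply (X j) f) U :=
      fun y hy => by simp [vfApply, hY y hy]
    have hs : ContDiffOn ℝ (⊤ : ℕ∞) (∑ j, (fun y => (a j y : ℂ)) * vfApply (X j) f) U := by
      simpa [Finset.sum_fn] using
        ContDiffOn.sum (s := Finset.univ) fun j _ => (ha' j).mul (hXf j)
    rw [List.foldl_cons, foldl_vfApply_congr hU hYf Ys hx] at h
    obtain ⟨w, hwl, hw⟩ := ih (fun Z hZ => hYs Z (List.mem_cons_of_mem _ hZ)) hs h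
    rw [wordDeriv_sum hU hX _ (F := fun j => (fun y => (a j y : ℂ)) * vfApply (X j) f) (fun j => (ha' j).mul (hXf j)) w hx, Finset.sum_apply] at hw
    obtain ⟨j, -, hj⟩ := Finset.exists_ne_zero_of_sum_ne_zero hw
    rw [wordDeriv_mul hU hX (ha' j) (hXf j) w hx] at hj
    obtain ⟨u, v, huv, -, hv⟩ := exists_mem_unshuffles_of_shuffleMul_ne_zero hj
    refine ⟨j :: v, ?_, hv⟩
    have := length_of_mem_unshuffles huv
    simp only [List.length_cons]
    omega

/-- The vanishing order may be computed using the generators alone. -/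
theorem vanishOrder_eq_wordOrder (hU : IsOpen U) (hX : ∀ j, ContDiffOn ℝ (⊤ : ℕ∞) (X j) U)
    {x : Rn n} (hx : x ∈ U) (hf : ContDiffOn ℝ (⊤ : ℕ∞) f U) :
    vanishOrder U X f x = wordOrder fun w => wordDeriv X f w x := by
  apply le_antisymm
  · refine le_sInf ?_
    rintro m ⟨w, rfl, hw⟩
    refine sInf_le ⟨w.map X, by simp, fun Y hY => ?_, by rwa [← wordDeriv_eq_foldl]⟩
    obtain ⟨j, -, rfl⟩ := List.mem_map.1 hY
    exact inModule_generator j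
  · refine le_sInf ?_
    rintro m ⟨Ys, rfl, hYs, h⟩
    obtain ⟨w, hwl, hw⟩ := exists_wordDeriv_ne_zero hU hX hx hYs hf h
    exact (wordOrder_le (F := fun w => wordDeriv X f w x) hw).trans (by exact_mod_cast hwl)

end VectorFields

/-- For germs of complex-valued smooth functions `f, g` at `p₀`,
`ν_𝒟(fg)(p₀) = ν_𝒟(f)(p₀) + ν_𝒟(g)(p₀)` (the sum is `∞` if either term is `∞`). -/
theorem vanishOrder_mul {n r : ℕ} (U : Set (Rn n)) (hU : IsOpen U) (p₀ : Rn n) (hp₀ : p₀ ∈ U)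
    (X : Fin r → Rn n → Rn n) (hX : ∀ j, ContDiffOn ℝ (⊤ : ℕ∞) (X j) U)
    (hind : ∀ x ∈ U, LinearIndependent ℝ (fun j => X j x))
    (f g : Rn n → ℂ) (hf : ContDiffOn ℝ (⊤ : ℕ∞) f U) (hg : ContDiffOn ℝ (⊤ : ℕ∞) g U) :
    vanishOrder U X (f * g) p₀ = vanishOrder U X f p₀ + vanishOrder U X g p₀ := by
  rw [vanishOrder_eq_wordOrder hU hX hp₀ (f := f * g) (hf.mul hg), vanishOrder_eq_wordOrder hU hX hp₀ hf,
    vanishOrder_eq_wordOrder hU hX hp₀ hg, ← wordOrder_shuffleMul]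
  congr 1
  funext w
  exact wordDeriv_mul hU hX hf hg w hp₀
end

section
/- Assume the Helffer–Nourrigat normalized setting for the vector fields X₁,…,X_r at 0 (normal form of the X_k and existence of the iterated commutators Y_{k,j} as in the context). Let f be a germ of a complex-valued smooth function at 0. If the weighted formal Taylor expansion of f at 0 (with wt(s′) = ∞) has lowest nonzero weighted homogeneous term f^{(m)} of weighted degree m, so that f = f^{(m)} + O_wt(m+1), then ν_𝒟(f)(0) = m. If f = O_wt(m) for every m, then ν_𝒟(f)(0) = ∞. -/
open Topology

/-- The index set for the coordinates `(x, s₁, …, s_h, s′)`: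
`x ∈ ℝ^r`, `s_j ∈ ℝ^{ℓ_j}`, `s′ ∈ ℝ^{m′}`. -/
abbrev HNIdx (r h m' : ℕ) (ℓ : Fin h → ℕ) := (Fin r ⊕ (Σ j : Fin h, Fin (ℓ j))) ⊕ Fin m'

/-- The coordinate space `ℝⁿ = ℝ^r × ℝ^{ℓ₁} × ⋯ × ℝ^{ℓ_h} × ℝ^{m′}`. -/
abbrev HNV (r h m' : ℕ) (ℓ : Fin h → ℕ) := HNIdx r h m' ℓ → ℝ

/-- The weights: `wt(x_k) = 1`, `wt(s_{j,q}) = m_j`, `wt(s′) = ∞`, where `mm j = m_j` are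
the Hörmander numbers. -/
def hnwt {r h m' : ℕ} {ℓ : Fin h → ℕ} (mm : Fin h → ℕ) : HNIdx r h m' ℓ → ℕ∞
  | .inl (.inl _) => 1
  | .inl (.inr s) => (mm s.1 : ℕ∞)
  | .inr _ => ⊤

/-- The partial derivative `∂f/∂u_i` in the `i`-th coordinate direction. -/
noncomputable def pdIdx {r h m' : ℕ} {ℓ : Fin h → ℕ} {E : Type*} [NormedAddCommGroup E]
    [NormedSpace ℝ E] (i : HNIdx r h m' ℓ) (f : HNV r h m' ℓ → E) : HNV r h m' ℓ → E :=
  fun x => fderiv ℝ f x (Pi.single i 1)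

/-- Iterated partial derivative along a list of coordinate directions. -/
noncomputable def pdList {r h m' : ℕ} {ℓ : Fin h → ℕ} {E : Type*} [NormedAddCommGroup E]
    [NormedSpace ℝ E] (L : List (HNIdx r h m' ℓ)) (f : HNV r h m' ℓ → E) :
    HNV r h m' ℓ → E :=
  L.foldl (fun g i => pdIdx i g) f

/-- The total weight (in `ℕ∞`) of a multi-index given as a list of coordinate directions. -/
def wsum {r h m' : ℕ} {ℓ : Fin h → ℕ} (mm : Fin h → ℕ) (L : List (HNIdx r h m' ℓ)) : ℕ∞ :=
  (L.map (hnwt mm)).sum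

/-- `f = O_wt(d)`: every term of the weighted formal Taylor expansion of `f` at `0` has
weight at least `d`, i.e. all weighted-degree `< d` Taylor coefficients vanish. -/
def FnBigOwt {r h m' : ℕ} {ℓ : Fin h → ℕ} {E : Type*} [NormedAddCommGroup E]
    [NormedSpace ℝ E] (mm : Fin h → ℕ) (d : ℤ) (f : HNV r h m' ℓ → E) : Prop :=
  ∀ L : List (HNIdx r h m' ℓ), ∀ sw : ℕ, wsum mm L = (sw : ℕ∞) → (sw : ℤ) < d →
    pdList L f 0 = 0

/-- A vector field is `O_wt(c)`: the component in a coordinate direction of finite weight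
`k` is `O_wt(k + c)` as a function, and components in the infinite-weight `s′` directions
are `O_wt(d)` for every `d` (all finite-weight Taylor coefficients vanish). -/
def VfBigOwt {r h m' : ℕ} {ℓ : Fin h → ℕ} (mm : Fin h → ℕ) (c : ℤ)
    (X : HNV r h m' ℓ → HNV r h m' ℓ) : Prop :=
  (∀ i : HNIdx r h m' ℓ, ∀ k : ℕ, hnwt mm i = (k : ℕ∞) →
    FnBigOwt mm ((k : ℤ) + c) (fun x => X x i)) ∧
  (∀ i : HNIdx r h m' ℓ, hnwt mm i = ⊤ → ∀ d : ℤ, FnBigOwt mm d (fun x => X x i))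

/-- The weighted dilation `(x, s_j, s′) ↦ (τ x, τ^{m_j} s_j, s′)`. -/
def hndil {r h m' : ℕ} {ℓ : Fin h → ℕ} (mm : Fin h → ℕ) (τ : ℝ) (x : HNV r h m' ℓ) :
    HNV r h m' ℓ := fun i =>
  match i with
  | .inl (.inl k) => τ * x (.inl (.inl k))
  | .inl (.inr s) => τ ^ (mm s.1) * x (.inl (.inr s))
  | .inr k' => x (.inr k')

/-- `P` is a (real) polynomial function on the coordinate space. -/
def IsPolyFn {r h m' : ℕ} {ℓ : Fin h → ℕ} (P : HNV r h m' ℓ → ℝ) : Prop :=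
  ∃ Q : MvPolynomial (HNIdx r h m' ℓ) ℝ, ∀ x, P x = MvPolynomial.eval x Q

/-- `P` is weighted homogeneous of degree `d`. -/
def WHomog {r h m' : ℕ} {ℓ : Fin h → ℕ} (mm : Fin h → ℕ) (d : ℕ)
    (P : HNV r h m' ℓ → ℝ) : Prop :=
  ∀ (τ : ℝ) (x : HNV r h m' ℓ), P (hndil mm τ x) = τ ^ d * P x

/-- `P` depends only on the variables `(x, s₁, …, s_{j-1})`. -/
def DependsOnBelow {r h m' : ℕ} {ℓ : Fin h → ℕ} (j : Fin h) (P : HNV r h m' ℓ → ℝ) : Prop :=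
  ∀ x y : HNV r h m' ℓ, (∀ k : Fin r, x (.inl (.inl k)) = y (.inl (.inl k))) →
    (∀ s : Σ j' : Fin h, Fin (ℓ j'), s.1 < j → x (.inl (.inr s)) = y (.inl (.inr s))) →
    P x = P y


/-- The `i`-th coordinate vector field `∂/∂u_i`. -/
def hnb {r h m' : ℕ} {ℓ : Fin h → ℕ} (i : HNIdx r h m' ℓ) : HNV r h m' ℓ := Pi.single i 1

/-- The Lie bracket of two vector fields. -/
noncomputable def lieB {r h m' : ℕ} {ℓ : Fin h → ℕ}
    (X Y : HNV r h m' ℓ → HNV r h m' ℓ) : HNV r h m' ℓ → HNV r h m' ℓ :=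
  fun p => fderiv ℝ Y p (X p) - fderiv ℝ X p (Y p)

/-- Iterated commutators `[X_{k_μ}, [⋯, [X_{k_2}, X_{k_1}]⋯]]` of length `μ` of vector
fields from `{X_1, …, X_r}`. -/
inductive IsIterComm {r h m' : ℕ} {ℓ : Fin h → ℕ}
    (X : Fin r → HNV r h m' ℓ → HNV r h m' ℓ) : ℕ → (HNV r h m' ℓ → HNV r h m' ℓ) → Prop
  | base (k : Fin r) : IsIterComm X 1 (X k)
  | step (k : Fin r) {μ : ℕ} {Z : HNV r h m' ℓ → HNV r h m' ℓ} :
      IsIterComm X μ Z → IsIterComm X (μ + 1) (lieB (X k) Z)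

/-- The Helffer–Nourrigat/Bouendi–Rothschild normalized setting at `0` for a system
`X₁, …, X_r` with Hörmander numbers `1 < m₁ < ⋯ < m_h` of multiplicities `ℓ₁, …, ℓ_h`. -/
structure HNSetting (r h m' : ℕ) (ℓ : Fin h → ℕ) (mm : Fin h → ℕ) where
  mono : StrictMono mm
  one_lt : ∀ j, 1 < mm j
  X : Fin r → HNV r h m' ℓ → HNV r h m' ℓ
  smoothX : ∀ k, ContDiff ℝ (⊤ : ℕ∞) (X k)
  P : Fin r → (j : Fin h) → Fin (ℓ j) → HNV r h m' ℓ → ℝ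
  Ppoly : ∀ k j q, IsPolyFn (P k j q)
  Phomog : ∀ k j q, WHomog mm (mm j - 1) (P k j q)
  Pdep : ∀ k j q, DependsOnBelow j (P k j q)
  Xform : ∀ k, VfBigOwt mm 0 (fun x => X k x -
    (hnb (Sum.inl (Sum.inl k)) +
      ∑ j : Fin h, ∑ q : Fin (ℓ j), P k j q x • hnb (Sum.inl (Sum.inr ⟨j, q⟩))))
  Y : (j : Fin h) → Fin (ℓ j) → HNV r h m' ℓ → HNV r h m' ℓ
  Ycomm : ∀ j q, IsIterComm X (mm j) (Y j q)
  Q : (k : Fin h) → Fin (ℓ k) → (τ : Fin h) → Fin (ℓ τ) → HNV r h m' ℓ → ℝ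
  Qpoly : ∀ k j τ q, IsPolyFn (Q k j τ q)
  Qhomog : ∀ k j τ q, WHomog mm (mm τ - mm k) (Q k j τ q)
  Qdep : ∀ k j τ q, DependsOnBelow k (Q k j τ q)
  Yform : ∀ k j, VfBigOwt mm (-(mm k : ℤ) + 1) (fun x => Y k j x -
    (hnb (Sum.inl (Sum.inr ⟨k, j⟩)) +
      ∑ τ : Fin h, ∑ q : Fin (ℓ τ),
        (if k < τ then Q k j τ q x else 0) • hnb (Sum.inl (Sum.inr ⟨τ, q⟩))))

/-- The action of a vector field on a function. -/
noncomputable def vfApplyHN {r h m' : ℕ} {ℓ : Fin h → ℕ} {E : Type*} [NormedAddCommGroup E]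
    [NormedSpace ℝ E] (Y : HNV r h m' ℓ → HNV r h m' ℓ) (f : HNV r h m' ℓ → E) :
    HNV r h m' ℓ → E :=
  fun x => fderiv ℝ f x (Y x)

/-- Membership in the `C^∞`-module `𝒟` of vector fields generated by `X₁, …, X_r`. -/
def InModuleHN {r h m' : ℕ} {ℓ : Fin h → ℕ} (X : Fin r → HNV r h m' ℓ → HNV r h m' ℓ)
    (Y : HNV r h m' ℓ → HNV r h m' ℓ) : Prop :=
  ∃ a : Fin r → HNV r h m' ℓ → ℝ, (∀ k, ContDiff ℝ (⊤ : ℕ∞) (a k)) ∧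
    ∀ x, Y x = ∑ k, a k x • X k x

/-- The vanishing order `ν_𝒟(f)(p)` along the module `𝒟` generated by `X₁, …, X_r`. -/
noncomputable def vanishOrderHN {r h m' : ℕ} {ℓ : Fin h → ℕ} {E : Type*}
    [NormedAddCommGroup E] [NormedSpace ℝ E] (X : Fin r → HNV r h m' ℓ → HNV r h m' ℓ)
    (f : HNV r h m' ℓ → E) (p : HNV r h m' ℓ) : ℕ∞ :=
  sInf {m : ℕ∞ | ∃ Ys : List (HNV r h m' ℓ → HNV r h m' ℓ), (Ys.length : ℕ∞) = m ∧
    (∀ Y ∈ Ys, InModuleHN X Y) ∧ (Ys.foldl (fun g Y => vfApplyHN Y g) f) p ≠ 0}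

section Calculus

variable {r h m' : ℕ} {ℓ : Fin h → ℕ} {E : Type*} [NormedAddCommGroup E] [NormedSpace ℝ E]

lemma ContDiff.pdIdx {f : HNV r h m' ℓ → E} (hf : ContDiff ℝ (⊤ : ℕ∞) f)
    (i : HNIdx r h m' ℓ) : ContDiff ℝ (⊤ : ℕ∞) (pdIdx i f) :=
  (hf.fderiv_right (by simp)).clm_apply contDiff_const

lemma ContDiff.vfApplyHN {Y : HNV r h m' ℓ → HNV r h m' ℓ} {f : HNV r h m' ℓ → E}
    (hY : ContDiff ℝ (⊤ : ℕ∞) Y) (hf : ContDiff ℝ (⊤ : ℕ∞) f) :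
    ContDiff ℝ (⊤ : ℕ∞) (vfApplyHN Y f) :=
  (hf.fderiv_right (by simp)).clm_apply hY

lemma ContDiff.differentiableAt_of_smooth {F : Type*} [NormedAddCommGroup F] [NormedSpace ℝ F]
    {f : F → E} (hf : ContDiff ℝ (⊤ : ℕ∞) f) (x : F) : DifferentiableAt ℝ f x :=
  (hf.differentiable (by simp)).differentiableAt

lemma pdIdx_add {f g : HNV r h m' ℓ → E} (hf : ContDiff ℝ (⊤ : ℕ∞) f)
    (hg : ContDiff ℝ (⊤ : ℕ∞) g) (i : HNIdx r h m' ℓ) :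
    pdIdx i (fun x => f x + g x) = fun x => pdIdx i f x + pdIdx i g x := by
  funext x
  simp [pdIdx, fderiv_fun_add (hf.differentiableAt_of_smooth x) (hg.differentiableAt_of_smooth x)]

lemma pdIdx_const_smul {f : HNV r h m' ℓ → E} (hf : ContDiff ℝ (⊤ : ℕ∞) f) (c : ℝ)
    (i : HNIdx r h m' ℓ) : pdIdx i (fun x => c • f x) = fun x => c • pdIdx i f x := by
  funext x
  simp [pdIdx, fderiv_fun_const_smul (hf.differentiableAt_of_smooth x)]

lemma pdIdx_smul {a : HNV r h m' ℓ → ℝ} {f : HNV r h m' ℓ → E}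
    (ha : ContDiff ℝ (⊤ : ℕ∞) a) (hf : ContDiff ℝ (⊤ : ℕ∞) f) (i : HNIdx r h m' ℓ) :
    pdIdx i (fun x => a x • f x) = fun x => a x • pdIdx i f x + pdIdx i a x • f x := by
  funext x
  simp [pdIdx, fderiv_fun_smul (ha.differentiableAt_of_smooth x) (hf.differentiableAt_of_smooth x)]

lemma pdList_cons (i : HNIdx r h m' ℓ) (L : List (HNIdx r h m' ℓ)) (f : HNV r h m' ℓ → E) :
    pdList (i :: L) f = pdList L (pdIdx i f) := rfl

lemma pdList_zero (L : List (HNIdx r h m' ℓ)) :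
    pdList L (fun _ : HNV r h m' ℓ => (0 : E)) = fun _ => 0 := by
  induction L with
  | nil => rfl
  | cons i L ih =>
    rw [pdList_cons]
    have : pdIdx i (fun _ : HNV r h m' ℓ => (0 : E)) = fun _ => 0 := by
      funext x
      simp [pdIdx]
    rw [this, ih]

lemma pdList_add (L : List (HNIdx r h m' ℓ)) {f g : HNV r h m' ℓ → E}
    (hf : ContDiff ℝ (⊤ : ℕ∞) f) (hg : ContDiff ℝ (⊤ : ℕ∞) g) :
    pdList L (fun x => f x + g x) = fun x => pdList L f x + pdList L g x := by
  induction L generalizing f g with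
  | nil => rfl
  | cons i L ih => rw [pdList_cons, pdIdx_add hf hg, ih (hf.pdIdx i) (hg.pdIdx i)]; rfl

lemma pdList_const_smul (L : List (HNIdx r h m' ℓ)) {f : HNV r h m' ℓ → E}
    (hf : ContDiff ℝ (⊤ : ℕ∞) f) (c : ℝ) :
    pdList L (fun x => c • f x) = fun x => c • pdList L f x := by
  induction L generalizing f with
  | nil => rfl
  | cons i L ih => rw [pdList_cons, pdIdx_const_smul hf, ih (hf.pdIdx i)]; rfl

lemma vfApplyHN_eq_sum (Y : HNV r h m' ℓ → HNV r h m' ℓ) (f : HNV r h m' ℓ → E)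
    (x : HNV r h m' ℓ) : vfApplyHN Y f x = ∑ i, Y x i • pdIdx i f x := by
  simp only [vfApplyHN, pdIdx]
  conv_lhs => rw [pi_eq_sum_univ' (Y x)]
  simp only [map_sum, map_smul]

lemma vfApplyHN_sub {f g : HNV r h m' ℓ → E} (hf : ContDiff ℝ (⊤ : ℕ∞) f)
    (hg : ContDiff ℝ (⊤ : ℕ∞) g) (Y : HNV r h m' ℓ → HNV r h m' ℓ) :
    vfApplyHN Y (fun x => f x - g x) = fun x => vfApplyHN Y f x - vfApplyHN Y g x := by
  funext x
  simp [vfApplyHN,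
    fderiv_fun_sub (hf.differentiableAt_of_smooth x) (hg.differentiableAt_of_smooth x)]

lemma ContDiff.lieB {X Y : HNV r h m' ℓ → HNV r h m' ℓ}
    (hX : ContDiff ℝ (⊤ : ℕ∞) X) (hY : ContDiff ℝ (⊤ : ℕ∞) Y) :
    ContDiff ℝ (⊤ : ℕ∞) (lieB X Y) :=
  ((hY.fderiv_right (by simp)).clm_apply hX).sub ((hX.fderiv_right (by simp)).clm_apply hY)

lemma vfApplyHN_lieB {X Y : HNV r h m' ℓ → HNV r h m' ℓ} {f : HNV r h m' ℓ → E}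
    (hX : ContDiff ℝ (⊤ : ℕ∞) X) (hY : ContDiff ℝ (⊤ : ℕ∞) Y) (hf : ContDiff ℝ (⊤ : ℕ∞) f) :
    vfApplyHN (lieB X Y) f =
      fun x => vfApplyHN X (vfApplyHN Y f) x - vfApplyHN Y (vfApplyHN X f) x := by
  funext x
  exact VectorField.fderiv_apply_lieBracket (n := ((⊤ : ℕ∞) : WithTop ℕ∞)) hf.contDiffAt
    (by simp only [minSmoothness_of_isRCLikeNormedField]; exact WithTop.coe_le_coe.mpr le_top)
    (hY.differentiableAt_of_smooth x) (hX.differentiableAt_of_smooth x)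

end Calculus

section Order

variable {r h m' : ℕ} {ℓ : Fin h → ℕ} {mm : Fin h → ℕ}
  {E : Type*} [NormedAddCommGroup E] [NormedSpace ℝ E]

/-- A list of directions of finite total weight splits into a head and a tail of finite weight. -/
lemma wsum_cons_eq_coe {i : HNIdx r h m' ℓ} {L : List (HNIdx r h m' ℓ)} {sw : ℕ}
    (hL : wsum mm (i :: L) = sw) :
    ∃ k n : ℕ, hnwt mm i = k ∧ wsum mm L = n ∧ k + n = sw := by
  simp only [wsum, List.map_cons, List.sum_cons] at hL
  have hfin : hnwt mm i + (L.map (hnwt mm)).sum ≠ ⊤ := by rw [hL]; exact ENat.natCast_ne_top _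
  rw [ne_eq, ENat.add_eq_top, not_or] at hfin
  obtain ⟨k, hk⟩ := ENat.ne_top_iff_exists.mp hfin.1
  obtain ⟨n, hn⟩ := ENat.ne_top_iff_exists.mp hfin.2
  rw [← hk, ← hn] at hL
  exact ⟨k, n, hk.symm, hn.symm, by exact_mod_cast hL⟩

namespace FnBigOwt

lemma mono {d d' : ℤ} {f : HNV r h m' ℓ → E} (hf : FnBigOwt mm d f) (hd : d' ≤ d) :
    FnBigOwt mm d' f := fun L sw hL hsw => hf L sw hL (hsw.trans_le hd)

lemma of_nonpos {d : ℤ} (hd : d ≤ 0) (f : HNV r h m' ℓ → E) : FnBigOwt mm d f :=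
  fun _ _ _ _ => by omega

lemma apply_zero {d : ℤ} {f : HNV r h m' ℓ → E} (hf : FnBigOwt mm d f) (hd : 0 < d) :
    f 0 = 0 := hf [] 0 (by simp [wsum]) (by simpa using hd)

lemma pdIdx {d : ℤ} {f : HNV r h m' ℓ → E} (hf : FnBigOwt mm d f) {i : HNIdx r h m' ℓ} {k : ℕ}
    (hk : hnwt mm i = k) : FnBigOwt mm (d - k) (pdIdx i f) := by
  intro L sw hL hsw
  refine hf (i :: L) (k + sw) ?_ (by push_cast; omega)
  simp only [wsum, List.map_cons, List.sum_cons] at hL ⊢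
  rw [hk, hL]; rfl

lemma of_pdIdx {d : ℤ} {f : HNV r h m' ℓ → E} (h0 : 0 < d → f 0 = 0)
    (hpd : ∀ (i : HNIdx r h m' ℓ) (k : ℕ), hnwt mm i = k →
      FnBigOwt mm (d - k) (_root_.pdIdx i f)) :
    FnBigOwt mm d f := by
  intro L sw hL hsw
  cases L with
  | nil => exact h0 (by omega)
  | cons i L =>
    obtain ⟨k, n, hk, hn, hkn⟩ := wsum_cons_eq_coe hL
    exact hpd i k hk L n hn (by omega)

lemma add {d : ℤ} {f g : HNV r h m' ℓ → E} (hf : FnBigOwt mm d f) (hg : FnBigOwt mm d g)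
    (hfs : ContDiff ℝ (⊤ : ℕ∞) f) (hgs : ContDiff ℝ (⊤ : ℕ∞) g) :
    FnBigOwt mm d (fun x => f x + g x) := by
  intro L sw hL hsw
  rw [pdList_add L hfs hgs]
  simp only [hf L sw hL hsw, hg L sw hL hsw, add_zero]

lemma sub {d : ℤ} {f g : HNV r h m' ℓ → E} (hf : FnBigOwt mm d f) (hg : FnBigOwt mm d g)
    (hfs : ContDiff ℝ (⊤ : ℕ∞) f) (hgs : ContDiff ℝ (⊤ : ℕ∞) g) :
    FnBigOwt mm d (fun x => f x - g x) := by
  have hg' : FnBigOwt mm d (fun x => (-1 : ℝ) • g x) := by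
    intro L sw hL hsw
    rw [pdList_const_smul L hgs]
    simp only [hg L sw hL hsw, smul_zero]
  simpa [sub_eq_add_neg] using hf.add hg' hfs (hgs.const_smul (-1 : ℝ))

lemma sum {ι : Type*} (s : Finset ι) {d : ℤ} {f : ι → HNV r h m' ℓ → E}
    (hf : ∀ i ∈ s, FnBigOwt mm d (f i)) (hfs : ∀ i ∈ s, ContDiff ℝ (⊤ : ℕ∞) (f i)) :
    FnBigOwt mm d (fun x => ∑ i ∈ s, f i x) := by
  classical
  induction s using Finset.induction_on with
  | empty =>
    intro L sw _ _
    simp [pdList_zero]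
  | insert i s hi ih =>
    simp only [Finset.sum_insert hi]
    simp only [Finset.forall_mem_insert] at hf hfs
    exact hf.1.add (ih hf.2 hfs.2) hfs.1 (ContDiff.sum hfs.2)

lemma smul {d e : ℤ} {a : HNV r h m' ℓ → ℝ} {f : HNV r h m' ℓ → E}
    (ha : FnBigOwt mm d a) (hf : FnBigOwt mm e f)
    (has : ContDiff ℝ (⊤ : ℕ∞) a) (hfs : ContDiff ℝ (⊤ : ℕ∞) f) :
    FnBigOwt mm (d + e) (fun x => a x • f x) := by
  intro L
  induction L generalizing d e a f with
  | nil =>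
    intro sw hL hsw
    rcases lt_or_ge 0 d with hd | hd
    · simp [pdList, ha.apply_zero hd]
    · simp [pdList, hf.apply_zero (by omega)]
  | cons i L ih =>
    intro sw hL hsw
    obtain ⟨k, n, hk, hn, hkn⟩ := wsum_cons_eq_coe hL
    rw [pdList_cons, pdIdx_smul has hfs,
      pdList_add L (f := fun x => a x • _root_.pdIdx i f x)
        (g := fun x => _root_.pdIdx i a x • f x)
        (has.smul (hfs.pdIdx i)) ((has.pdIdx i).smul hfs)]
    simp only
    rw [ih ha (hf.pdIdx hk) has (hfs.pdIdx i) n hn (by omega),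
      ih (ha.pdIdx hk) hf (has.pdIdx i) hfs n hn (by omega), add_zero]

end FnBigOwt

/-- A vector field of weight at least `c` raises the weighted order by at least `c`. -/
lemma VfBigOwt.vfApplyHN {c d : ℤ} {X : HNV r h m' ℓ → HNV r h m' ℓ} {f : HNV r h m' ℓ → E}
    (hX : VfBigOwt mm c X) (hf : FnBigOwt mm d f)
    (hXs : ContDiff ℝ (⊤ : ℕ∞) X) (hfs : ContDiff ℝ (⊤ : ℕ∞) f) :
    FnBigOwt mm (d + c) (vfApplyHN X f) := by
  have hXi : ∀ i, ContDiff ℝ (⊤ : ℕ∞) (fun x => X x i) := fun i => contDiff_pi.mp hXs i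
  rw [funext (vfApplyHN_eq_sum X f)]
  refine FnBigOwt.sum _ (fun i _ => ?_) (fun i _ => (hXi i).smul (hfs.pdIdx i))
  by_cases hi : hnwt mm i = ⊤
  · exact ((hX.2 i hi (d + c)).smul (FnBigOwt.of_nonpos le_rfl _) (hXi i) (hfs.pdIdx i)).mono
      (by omega)
  · obtain ⟨k, hk⟩ := ENat.ne_top_iff_exists.mp hi
    exact ((hX.1 i k hk.symm).smul (hf.pdIdx hk.symm) (hXi i) (hfs.pdIdx i)).mono (by omega)

end Order

section Homogeneous

variable {r h m' : ℕ} {ℓ : Fin h → ℕ} {mm : Fin h → ℕ}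
  {E : Type*} [NormedAddCommGroup E] [NormedSpace ℝ E]

lemma isLinearMap_hndil (τ : ℝ) : IsLinearMap ℝ (hndil (r := r) (m' := m') (ℓ := ℓ) mm τ) where
  map_add x y := by
    funext i
    rcases i with (i | i) | i <;> simp [hndil, mul_add]
  map_smul c x := by
    funext i
    rcases i with (i | i) | i <;> simp [hndil, mul_left_comm]

lemma hndil_single {i : HNIdx r h m' ℓ} {k : ℕ} (hk : hnwt mm i = k) (τ : ℝ) :
    hndil mm τ (Pi.single i 1) = τ ^ k • (Pi.single i 1 : HNV r h m' ℓ) := by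
  funext j
  by_cases hj : j = i
  · subst hj
    rcases j with (j | j) | j
    · have : 1 = k := by simpa [hnwt, eq_comm] using hk
      simp [hndil, ← this]
    · have : mm j.1 = k := by simpa [hnwt] using hk
      simp [hndil, ← this]
    · simp [hnwt] at hk
  · rcases j with (j | j) | j <;> simp [hndil, hj]

lemma contDiff_hndil (τ : ℝ) :
    ContDiff ℝ (⊤ : ℕ∞) (hndil (r := r) (m' := m') (ℓ := ℓ) mm τ) :=
  (LinearMap.toContinuousLinearMap ((isLinearMap_hndil τ).mk' _)).contDiff

lemma pdIdx_comp_hndil {f : HNV r h m' ℓ → E} (hf : ContDiff ℝ (⊤ : ℕ∞) f) (τ : ℝ)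
    {i : HNIdx r h m' ℓ} {k : ℕ} (hk : hnwt mm i = k) :
    pdIdx i (fun x => f (hndil mm τ x)) = fun x => τ ^ k • pdIdx i f (hndil mm τ x) := by
  funext x
  let D := LinearMap.toContinuousLinearMap ((isLinearMap_hndil (r := r) (m' := m') (ℓ := ℓ)
    (mm := mm) τ).mk' _)
  have hD : HasFDerivAt (hndil mm τ) D x := D.hasFDerivAt
  have hcomp : HasFDerivAt (fun x => f (hndil mm τ x)) _ x :=
    (hf.differentiableAt_of_smooth (hndil mm τ x)).hasFDerivAt.comp x hD
  rw [pdIdx, hcomp.fderiv, ContinuousLinearMap.comp_apply]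
  have : D (Pi.single i 1) = τ ^ k • (Pi.single i 1 : HNV r h m' ℓ) := hndil_single hk τ
  rw [this, map_smul, pdIdx]

lemma pdList_comp_hndil {f : HNV r h m' ℓ → E} (hf : ContDiff ℝ (⊤ : ℕ∞) f) (τ : ℝ)
    {L : List (HNIdx r h m' ℓ)} {sw : ℕ} (hL : wsum mm L = sw) :
    pdList L (fun x => f (hndil mm τ x)) = fun x => τ ^ sw • pdList L f (hndil mm τ x) := by
  induction L generalizing f sw with
  | nil =>
    have : sw = 0 := by simpa [wsum, eq_comm] using hL
    simp [pdList, this]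
  | cons i L ih =>
    obtain ⟨k, n, hk, hn, rfl⟩ := wsum_cons_eq_coe hL
    rw [pdList_cons, pdIdx_comp_hndil hf τ hk,
      pdList_const_smul L (f := fun x => pdIdx i f (hndil mm τ x))
        ((hf.pdIdx i).comp (contDiff_hndil τ)), ih (hf.pdIdx i) hn]
    simp only [smul_smul, pow_add]
    rfl

/-- The Taylor coefficients of a weighted homogeneous function of degree `m` vanish in every
finite weight other than `m`. -/
lemma pdList_zero_of_homogeneous {m : ℕ} {f : HNV r h m' ℓ → E} (hf : ContDiff ℝ (⊤ : ℕ∞) f)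
    (hom : ∀ (τ : ℝ) (x : HNV r h m' ℓ), f (hndil mm τ x) = τ ^ m • f x)
    {L : List (HNIdx r h m' ℓ)} {sw : ℕ} (hL : wsum mm L = sw) (hsw : sw ≠ m) :
    pdList L f 0 = 0 := by
  have h1 := congrFun (pdList_comp_hndil hf 2 hL) 0
  rw [funext (hom 2), pdList_const_smul L hf, (isLinearMap_hndil 2).map_zero] at h1
  simp only at h1
  rw [← sub_eq_zero, ← sub_smul, smul_eq_zero, sub_eq_zero] at h1
  exact h1.resolve_left fun h2 => hsw (pow_right_injective₀ (by norm_num) (by norm_num) h2).symm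

lemma FnBigOwt.of_homogeneous {m : ℕ} {f : HNV r h m' ℓ → E} (hf : ContDiff ℝ (⊤ : ℕ∞) f)
    (hom : ∀ (τ : ℝ) (x : HNV r h m' ℓ), f (hndil mm τ x) = τ ^ m • f x) :
    FnBigOwt mm m f :=
  fun _ _ hL hsw => pdList_zero_of_homogeneous hf hom hL (by omega)

end Homogeneous

section Polynomial

variable {r h m' : ℕ} {ℓ : Fin h → ℕ}

lemma MvPolynomial.contDiff_eval_comp {σ F A : Type*} [NormedAddCommGroup F] [NormedSpace ℝ F]
    [NormedCommRing A] [NormedAlgebra ℝ A] {g : F → σ → A}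
    (hg : ∀ i, ContDiff ℝ (⊤ : ℕ∞) (fun x => g x i)) (Q : MvPolynomial σ A) :
    ContDiff ℝ (⊤ : ℕ∞) (fun x => MvPolynomial.eval (g x) Q) := by
  induction Q using MvPolynomial.induction_on with
  | C a => simpa using contDiff_const
  | add p q hp hq => simpa using hp.add hq
  | mul_X p i hp => simpa using hp.mul (hg i)

lemma contDiff_ofReal_coord (i : HNIdx r h m' ℓ) :
    ContDiff ℝ (⊤ : ℕ∞) (fun x : HNV r h m' ℓ => (x i : ℂ)) :=
  Complex.ofRealCLM.contDiff.comp (contDiff_apply ℝ ℝ i)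

lemma pdIdx_eval_ofReal (i : HNIdx r h m' ℓ) (Q : MvPolynomial (HNIdx r h m' ℓ) ℂ) :
    pdIdx i (fun x : HNV r h m' ℓ => MvPolynomial.eval (fun j => (x j : ℂ)) Q) =
      fun x => MvPolynomial.eval (fun j => (x j : ℂ)) (MvPolynomial.pderiv i Q) := by
  have hsm := MvPolynomial.contDiff_eval_comp (contDiff_ofReal_coord (r := r) (m' := m') (ℓ := ℓ))
  induction Q using MvPolynomial.induction_on with
  | C a => funext x; simp [pdIdx]
  | add p q hp hq => simp only [map_add]; rw [pdIdx_add (hsm p) (hsm q), hp, hq]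
  | mul_X p j hp =>
    funext x
    have hX : HasFDerivAt (fun x : HNV r h m' ℓ => (x j : ℂ))
        (Complex.ofRealCLM.comp (ContinuousLinearMap.proj j)) x :=
      (Complex.ofRealCLM.comp (ContinuousLinearMap.proj (R := ℝ) (φ := fun _ => ℝ) j)).hasFDerivAt
    have hmul := ((hsm p).differentiableAt_of_smooth x).hasFDerivAt.mul hX
    have hpx := congrFun hp x
    simp only [pdIdx] at hpx
    simp only [pdIdx, map_mul, MvPolynomial.eval_X]
    rw [show (fun x : HNV r h m' ℓ => MvPolynomial.eval (fun j => (x j : ℂ)) p * (x j : ℂ)) =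
      (fun x => MvPolynomial.eval (fun j => (x j : ℂ)) p) * fun x => (x j : ℂ) from rfl,
      hmul.fderiv]
    by_cases hij : i = j
    · subst hij
      simp [hpx, mul_comm]
    · simp [hpx, MvPolynomial.pderiv_X_of_ne (Ne.symm hij), mul_comm,
        Pi.single_eq_of_ne (Ne.symm hij)]

/-- A polynomial function all of whose partial derivatives vanish at `0` is zero. -/
lemma eval_ofReal_eq_zero_of_pdList (n : ℕ) (Q : MvPolynomial (HNIdx r h m' ℓ) ℂ)
    (hn : ∀ s : HNIdx r h m' ℓ →₀ ℕ, n ≤ s.degree → Q.coeff s = 0)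
    (hQ : ∀ L, pdList L (fun x : HNV r h m' ℓ => MvPolynomial.eval (fun j => (x j : ℂ)) Q) 0 = 0)
    (x : HNV r h m' ℓ) : MvPolynomial.eval (fun j => (x j : ℂ)) Q = 0 := by
  induction n generalizing Q x with
  | zero =>
    have : Q = 0 := by
      ext s
      simpa using hn s (Nat.zero_le _)
    simp [this]
  | succ n ih =>
    have hsm := MvPolynomial.contDiff_eval_comp
      (contDiff_ofReal_coord (r := r) (m' := m') (ℓ := ℓ)) Q
    have hpd : ∀ i x, pdIdx i (fun x : HNV r h m' ℓ =>
        MvPolynomial.eval (fun j => (x j : ℂ)) Q) x = 0 := by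
      intro i x
      rw [pdIdx_eval_ofReal]
      refine ih _ (fun s hs => ?_) (fun L => ?_) x
      · rw [MvPolynomial.coeff_pderiv, hn _ (by simpa using hs), zero_mul]
      · rw [← pdIdx_eval_ofReal]
        exact hQ (i :: L)
    have hconst := is_const_of_fderiv_eq_zero (hsm.differentiable (by simp)) (fun y => by
      ext v
      have := vfApplyHN_eq_sum (fun _ => v)
        (fun x : HNV r h m' ℓ => MvPolynomial.eval (fun j => (x j : ℂ)) Q) y
      simp only [hpd, smul_zero, Finset.sum_const_zero] at this
      exact this) x 0
    exact hconst.trans (hQ [])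

end Polynomial

section Words

variable {r h m' : ℕ} {ℓ : Fin h → ℕ} {E : Type*} [NormedAddCommGroup E] [NormedSpace ℝ E]
  {X : Fin r → HNV r h m' ℓ → HNV r h m' ℓ}

/-- All compositions of length `n` of the operators `X₁, …, X_r`, applied to `f`, vanish at `0`. -/
def WordsVanish (X : Fin r → HNV r h m' ℓ → HNV r h m' ℓ) : ℕ → (HNV r h m' ℓ → E) → Prop
  | 0, f => f 0 = 0
  | n + 1, f => ∀ k, WordsVanish X n (vfApplyHN (X k) f)

lemma WordsVanish.sub (hX : ∀ k, ContDiff ℝ (⊤ : ℕ∞) (X k)) {n : ℕ} {f g : HNV r h m' ℓ → E}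
    (hf : ContDiff ℝ (⊤ : ℕ∞) f) (hg : ContDiff ℝ (⊤ : ℕ∞) g)
    (hfv : WordsVanish X n f) (hgv : WordsVanish X n g) :
    WordsVanish X n (fun x => f x - g x) := by
  induction n generalizing f g with
  | zero =>
    change f 0 - g 0 = 0
    rw [show f 0 = 0 from hfv, show g 0 = 0 from hgv, sub_zero]
  | succ n ih =>
    intro k
    rw [vfApplyHN_sub hf hg]
    exact ih ((hX k).vfApplyHN hf) ((hX k).vfApplyHN hg) (hfv k) (hgv k)

lemma IsIterComm.contDiff (hX : ∀ k, ContDiff ℝ (⊤ : ℕ∞) (X k)) {μ : ℕ}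
    {Z : HNV r h m' ℓ → HNV r h m' ℓ} (hZ : IsIterComm X μ Z) : ContDiff ℝ (⊤ : ℕ∞) Z := by
  induction hZ with
  | base k => exact hX k
  | step k _ ih => exact (hX k).lieB ih

/-- An iterated commutator of length `μ` acts as a combination of words of length `μ`. -/
lemma WordsVanish.iterComm (hX : ∀ k, ContDiff ℝ (⊤ : ℕ∞) (X k)) {μ : ℕ}
    {Z : HNV r h m' ℓ → HNV r h m' ℓ} (hZ : IsIterComm X μ Z) {n : ℕ} {f : HNV r h m' ℓ → E}
    (hf : ContDiff ℝ (⊤ : ℕ∞) f) (hfv : WordsVanish X (n + μ) f) :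
    WordsVanish X n (vfApplyHN Z f) := by
  induction hZ generalizing n f with
  | base k => exact hfv k
  | @step k μ Z hZ ih =>
    have hZs := hZ.contDiff hX
    rw [vfApplyHN_lieB (hX k) hZs hf]
    refine .sub hX ((hX k).vfApplyHN (hZs.vfApplyHN hf)) (hZs.vfApplyHN ((hX k).vfApplyHN hf))
      ?_ (ih ((hX k).vfApplyHN hf) (hfv k))
    have hfv' : WordsVanish X (n + 1 + μ) f := by
      rwa [show n + 1 + μ = n + (μ + 1) by omega]
    exact ih hf hfv' k

lemma inModuleHN_self (k : Fin r) : InModuleHN X (X k) := by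
  classical
  refine ⟨fun j _ => if j = k then 1 else 0, fun j => contDiff_const, fun x => ?_⟩
  simp

lemma exists_list_of_not_wordsVanish {n : ℕ} {f : HNV r h m' ℓ → E} (hf : ¬ WordsVanish X n f) :
    ∃ Ys : List (HNV r h m' ℓ → HNV r h m' ℓ), Ys.length = n ∧ (∀ Y ∈ Ys, InModuleHN X Y) ∧
      (Ys.foldl (fun g Y => vfApplyHN Y g) f) 0 ≠ 0 := by
  induction n generalizing f with
  | zero => exact ⟨[], rfl, by simp, hf⟩
  | succ n ih =>
    simp only [WordsVanish, not_forall] at hf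
    obtain ⟨k, hk⟩ := hf
    obtain ⟨Ys, hlen, hmem, hne⟩ := ih hk
    exact ⟨X k :: Ys, by simp [hlen], by simpa using ⟨inModuleHN_self k, hmem⟩, hne⟩

end Words

section LeadingPart

variable {r h m' : ℕ} {ℓ : Fin h → ℕ} {mm : Fin h → ℕ}
  {E : Type*} [NormedAddCommGroup E] [NormedSpace ℝ E]

/-- If `X = ∂_i + ∑ c_{j,q} ∂_{s_{j,q}}` up to a remainder of weight at least `w`, and the
correction terms do not matter in weighted order `e`, then `X f` and `∂_i f` agree to order `e`. -/
lemma bigOwt_vfApplyHN_iff {w d e : ℤ} {X : HNV r h m' ℓ → HNV r h m' ℓ} {i : HNIdx r h m' ℓ}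
    {c : (j : Fin h) → Fin (ℓ j) → HNV r h m' ℓ → ℝ} {f : HNV r h m' ℓ → E}
    (hXs : ContDiff ℝ (⊤ : ℕ∞) X) (hcs : ∀ j q, ContDiff ℝ (⊤ : ℕ∞) (c j q))
    (hfs : ContDiff ℝ (⊤ : ℕ∞) f)
    (hX : VfBigOwt mm w (fun x => X x -
      (hnb i + ∑ j : Fin h, ∑ q : Fin (ℓ j), c j q x • hnb (Sum.inl (Sum.inr ⟨j, q⟩)))))
    (hf : FnBigOwt mm d f) (hed : e ≤ d + w)
    (hc : ∀ j q, FnBigOwt mm e (fun x => c j q x • pdIdx (Sum.inl (Sum.inr ⟨j, q⟩)) f x)) :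
    FnBigOwt mm e (vfApplyHN X f) ↔ FnBigOwt mm e (pdIdx i f) := by
  set V : HNV r h m' ℓ → HNV r h m' ℓ := fun x =>
    hnb i + ∑ j : Fin h, ∑ q : Fin (ℓ j), c j q x • hnb (Sum.inl (Sum.inr ⟨j, q⟩)) with hV
  set C : HNV r h m' ℓ → E := fun x =>
    ∑ j : Fin h, ∑ q : Fin (ℓ j), c j q x • pdIdx (Sum.inl (Sum.inr ⟨j, q⟩)) f x with hC
  have hVs : ContDiff ℝ (⊤ : ℕ∞) V := contDiff_const.add
    (ContDiff.sum fun j _ => ContDiff.sum fun q _ => (hcs j q).smul contDiff_const)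
  have hterm : ∀ j q, ContDiff ℝ (⊤ : ℕ∞)
      (fun x => c j q x • pdIdx (Sum.inl (Sum.inr ⟨j, q⟩)) f x) :=
    fun j q => (hcs j q).smul (hfs.pdIdx _)
  have hCs : ContDiff ℝ (⊤ : ℕ∞) C :=
    ContDiff.sum fun j _ => ContDiff.sum fun q _ => hterm j q
  have hCo : FnBigOwt mm e C := FnBigOwt.sum _
    (fun j _ => FnBigOwt.sum _ (fun q _ => hc j q) fun q _ => hterm j q)
    (fun j _ => ContDiff.sum fun q _ => hterm j q)
  have hR := (hX.vfApplyHN hf (hXs.sub hVs) hfs).mono hed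
  have hRs := (hXs.sub hVs).vfApplyHN hfs
  have heq : ∀ x, vfApplyHN X f x = pdIdx i f x + C x + vfApplyHN (fun x => X x - V x) f x := by
    intro x
    simp [vfApplyHN, hV, hC, pdIdx, hnb, map_sum]
  constructor
  · intro hXf
    have h1 := (hXf.sub hCo (hXs.vfApplyHN hfs) hCs).sub hR ((hXs.vfApplyHN hfs).sub hCs) hRs
    convert h1 using 2 with x
    rw [heq]
    abel
  · intro hpd
    rw [funext heq]
    exact (hpd.add hCo (hfs.pdIdx i) hCs).add hR ((hfs.pdIdx i).add hCs) hRs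

end LeadingPart

namespace HNSetting

variable {r h m' : ℕ} {ℓ : Fin h → ℕ} {mm : Fin h → ℕ}
  {E : Type*} [NormedAddCommGroup E] [NormedSpace ℝ E] (S : HNSetting r h m' ℓ mm)

lemma one_le_of_hnwt (S : HNSetting r h m' ℓ mm) {i : HNIdx r h m' ℓ} {k : ℕ}
    (hk : hnwt mm i = k) : 1 ≤ k := by
  rcases i with (i | ⟨j, q⟩) | i
  · have : 1 = k := by simpa [hnwt, eq_comm] using hk
    omega
  · have : mm j = k := by simpa [hnwt] using hk
    have := S.one_lt j
    omega
  · simp [hnwt] at hk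

lemma contDiff_of_isPolyFn {P : HNV r h m' ℓ → ℝ} (hP : IsPolyFn P) :
    ContDiff ℝ (⊤ : ℕ∞) P := by
  obtain ⟨Q, hQ⟩ := hP
  rw [funext hQ]
  exact MvPolynomial.contDiff_eval_comp (fun i => contDiff_apply ℝ ℝ i) Q

lemma bigOwt_P (k : Fin r) (j : Fin h) (q : Fin (ℓ j)) :
    FnBigOwt mm ((mm j : ℤ) - 1) (S.P k j q) := by
  have := FnBigOwt.of_homogeneous (contDiff_of_isPolyFn (S.Ppoly k j q)) (S.Phomog k j q)
  rwa [Nat.cast_sub (S.one_lt j).le, Nat.cast_one] at this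

lemma bigOwt_Q {k τ : Fin h} (hkτ : k < τ) (j : Fin (ℓ k)) (q : Fin (ℓ τ)) :
    FnBigOwt mm ((mm τ : ℤ) - mm k) (S.Q k j τ q) := by
  have := FnBigOwt.of_homogeneous (contDiff_of_isPolyFn (S.Qpoly k j τ q)) (S.Qhomog k j τ q)
  rwa [Nat.cast_sub (S.mono hkτ).le] at this

lemma bigOwt_X_iff {d e : ℤ} {f : HNV r h m' ℓ → E} (hfs : ContDiff ℝ (⊤ : ℕ∞) f)
    (hf : FnBigOwt mm d f) (hed : e ≤ d) (k : Fin r)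
    (hs : ∀ j q, FnBigOwt mm (e + 1 - mm j) (pdIdx (Sum.inl (Sum.inr ⟨j, q⟩)) f)) :
    FnBigOwt mm e (vfApplyHN (S.X k) f) ↔ FnBigOwt mm e (pdIdx (Sum.inl (Sum.inl k)) f) :=
  have hPs := fun j q => contDiff_of_isPolyFn (S.Ppoly k j q)
  bigOwt_vfApplyHN_iff (S.smoothX k) hPs hfs (S.Xform k) hf (by omega) fun j q =>
    ((S.bigOwt_P k j q).smul (hs j q) (hPs j q) (hfs.pdIdx _)).mono (by omega)

lemma bigOwt_Y_iff {d e : ℤ} {f : HNV r h m' ℓ → E} (hfs : ContDiff ℝ (⊤ : ℕ∞) f)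
    (hf : FnBigOwt mm d f) {k : Fin h} (hed : e ≤ d + 1 - mm k) (j : Fin (ℓ k))
    (hs : ∀ τ q, k < τ →
      FnBigOwt mm (e + mm k - mm τ) (pdIdx (Sum.inl (Sum.inr ⟨τ, q⟩)) f)) :
    FnBigOwt mm e (vfApplyHN (S.Y k j) f) ↔
      FnBigOwt mm e (pdIdx (Sum.inl (Sum.inr ⟨k, j⟩)) f) := by
  have hQs := fun τ q => contDiff_of_isPolyFn (S.Qpoly k j τ q)
  refine bigOwt_vfApplyHN_iff (c := fun τ q x => if k < τ then S.Q k j τ q x else 0)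
    ((S.Ycomm k j).contDiff S.smoothX) (fun τ q => ?_) hfs (S.Yform k j) hf (by omega)
    fun τ q => ?_
  · by_cases hkτ : k < τ
    · simpa [hkτ] using hQs τ q
    · simpa [hkτ] using contDiff_const
  · by_cases hkτ : k < τ
    · simpa [hkτ] using ((S.bigOwt_Q hkτ j q).smul (hs τ q hkτ) (hQs τ q) (hfs.pdIdx _)).mono
        (by omega)
    · intro L _ _ _
      simp [hkτ, pdList_zero]

lemma bigOwt_X {d : ℤ} {f : HNV r h m' ℓ → E} (hfs : ContDiff ℝ (⊤ : ℕ∞) f)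
    (hf : FnBigOwt mm d f) (k : Fin r) : FnBigOwt mm (d - 1) (vfApplyHN (S.X k) f) :=
  (S.bigOwt_X_iff hfs hf (by omega) k fun j q =>
    (hf.pdIdx (k := mm j) rfl).mono (by omega)).mpr (hf.pdIdx (k := 1) rfl)

/-- If `f` has weighted order at least `m` and all words of length `m` in the `X_k` annihilate `f`
at `0`, then `f` has weighted order at least `m + 1`. -/
theorem bigOwt_succ_of_wordsVanish (m : ℕ) (f : HNV r h m' ℓ → E)
    (hfs : ContDiff ℝ (⊤ : ℕ∞) f) (hf : FnBigOwt mm m f) (hfv : WordsVanish S.X m f) :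
    FnBigOwt mm ((m : ℤ) + 1) f := by
  induction m using Nat.strong_induction_on generalizing f with
  | _ m ih =>
  rcases Nat.eq_zero_or_pos m with rfl | hm
  · refine FnBigOwt.of_pdIdx (fun _ => hfv) fun i k hk => FnBigOwt.of_nonpos ?_ _
    have := S.one_le_of_hnwt hk
    simp only [Nat.cast_zero]
    omega
  have hs : ∀ j q, FnBigOwt mm ((m : ℤ) + 1 - mm j) (pdIdx (Sum.inl (Sum.inr ⟨j, q⟩)) f) := by
    intro j
    induction j using WellFoundedGT.induction with
    | _ j ihj =>
    intro q
    rcases lt_or_ge m (mm j) with hmj | hmj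
    · exact FnBigOwt.of_nonpos (by omega) _
    have hj := S.one_lt j
    have hYs := ((S.Ycomm j q).contDiff S.smoothX).vfApplyHN hfs
    have hY : FnBigOwt mm ((m - mm j : ℕ) : ℤ) (vfApplyHN (S.Y j q) f) := by
      rw [Nat.cast_sub hmj]
      exact (S.bigOwt_Y_iff hfs hf (by omega) q fun τ p hτ =>
        (ihj τ hτ p).mono (by omega)).mpr (hf.pdIdx (k := mm j) rfl)
    have hYv : WordsVanish S.X (m - mm j) (vfApplyHN (S.Y j q) f) :=
      WordsVanish.iterComm S.smoothX (S.Ycomm j q) hfs (by rwa [Nat.sub_add_cancel hmj])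
    exact (S.bigOwt_Y_iff hfs hf (by omega) q fun τ p hτ => (ihj τ hτ p).mono (by omega)).mp
      ((ih _ (by omega) _ hYs hY hYv).mono (by omega))
  have hx : ∀ k, FnBigOwt mm m (pdIdx (Sum.inl (Sum.inl k)) f) := by
    intro k
    obtain ⟨n, rfl⟩ := Nat.exists_eq_add_of_lt hm
    rw [zero_add] at *
    exact (S.bigOwt_X_iff hfs hf le_rfl k hs).mp
      ((ih n (by omega) _ ((S.smoothX k).vfApplyHN hfs)
        ((S.bigOwt_X hfs hf k).mono (by omega)) (hfv k)).mono (by omega))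
  refine FnBigOwt.of_pdIdx (fun _ => hf.apply_zero (by omega)) fun i k hk => ?_
  rcases i with (i | ⟨j, q⟩) | i
  · have : 1 = k := by simpa [hnwt, eq_comm] using hk
    exact (hx i).mono (by omega)
  · have : mm j = k := by simpa [hnwt] using hk
    exact (hs j q).mono (by omega)
  · simp [hnwt] at hk

lemma bigOwt_vfApplyHN_of_inModuleHN {d : ℤ} {f : HNV r h m' ℓ → E}
    (hfs : ContDiff ℝ (⊤ : ℕ∞) f) (hf : FnBigOwt mm d f) {Y : HNV r h m' ℓ → HNV r h m' ℓ}
    (hY : InModuleHN S.X Y) :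
    ContDiff ℝ (⊤ : ℕ∞) (vfApplyHN Y f) ∧ FnBigOwt mm (d - 1) (vfApplyHN Y f) := by
  obtain ⟨a, ha, hYa⟩ := hY
  have heq : vfApplyHN Y f = fun x => ∑ k, a k x • vfApplyHN (S.X k) f x := by
    funext x
    simp [vfApplyHN, hYa, map_sum]
  have hterm : ∀ k, ContDiff ℝ (⊤ : ℕ∞) (fun x => a k x • vfApplyHN (S.X k) f x) :=
    fun k => (ha k).smul ((S.smoothX k).vfApplyHN hfs)
  rw [heq]
  refine ⟨ContDiff.sum fun k _ => hterm k, FnBigOwt.sum _ (fun k _ => ?_) fun k _ => hterm k⟩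
  exact ((FnBigOwt.of_nonpos le_rfl (a k)).smul (S.bigOwt_X hfs hf k) (ha k)
    ((S.smoothX k).vfApplyHN hfs)).mono (by omega)

lemma foldl_vfApplyHN_eq_zero {d : ℤ} {f : HNV r h m' ℓ → E} (hfs : ContDiff ℝ (⊤ : ℕ∞) f)
    (hf : FnBigOwt mm d f) {Ys : List (HNV r h m' ℓ → HNV r h m' ℓ)}
    (hYs : ∀ Y ∈ Ys, InModuleHN S.X Y) (hlen : (Ys.length : ℤ) < d) :
    (Ys.foldl (fun g Y => vfApplyHN Y g) f) 0 = 0 := by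
  induction Ys generalizing f d with
  | nil => exact hf.apply_zero (by simpa using hlen)
  | cons Y Ys ih =>
    rw [List.forall_mem_cons] at hYs
    obtain ⟨hs, ho⟩ := S.bigOwt_vfApplyHN_of_inModuleHN hfs hf hYs.1
    exact ih hs ho hYs.2 (by simp only [List.length_cons] at hlen; push_cast at hlen; omega)

end HNSetting

/-- Derivatives of infinite weight annihilate functions independent of the `s′` variables. -/
lemma pdList_eq_zero_of_wsum_eq_top {r h m' : ℕ} {ℓ : Fin h → ℕ} {mm : Fin h → ℕ}
    {E : Type*} [NormedAddCommGroup E] [NormedSpace ℝ E] {f : HNV r h m' ℓ → E}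
    (hfs : ContDiff ℝ (⊤ : ℕ∞) f)
    (hdep : ∀ x y : HNV r h m' ℓ,
      (∀ i : Fin r ⊕ (Σ j : Fin h, Fin (ℓ j)), x (Sum.inl i) = y (Sum.inl i)) → f x = f y)
    {L : List (HNIdx r h m' ℓ)} (hL : wsum mm L = ⊤) : pdList L f = fun _ => 0 := by
  induction L generalizing f with
  | nil => simp [wsum] at hL
  | cons i L ih =>
    rw [pdList_cons]
    rcases i with i | i
    · refine ih (hfs.pdIdx _) (fun x y hxy => ?_) ?_
      · have htrans : (fun z => f (z + (y - x))) = f :=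
          funext fun z => hdep _ _ fun j => by simp [hxy]
        have := fderiv_comp_add_right (𝕜 := ℝ) (f := f) (x := x) (y - x)
        rw [htrans, add_sub_cancel] at this
        rw [pdIdx, pdIdx, this]
      · have hi : hnwt mm (Sum.inl i : HNIdx r h m' ℓ) ≠ ⊤ := by
          rcases i with i | i <;> simp [hnwt]
        simp only [wsum, List.map_cons, List.sum_cons, ENat.add_eq_top] at hL
        exact hL.resolve_left hi
    · have : pdIdx (Sum.inr i) f = fun _ => 0 := by
        funext x
        rw [pdIdx, ← (hfs.differentiableAt_of_smooth x).lineDeriv_eq_fderiv, lineDeriv]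
        have hc : (fun t : ℝ => f (x + t • Pi.single (Sum.inr i) 1)) = fun _ => f x :=
          funext fun t => hdep _ _ fun j => by simp
        rw [hc, deriv_const]
      rw [this, pdList_zero]

/-- A nonzero weighted homogeneous polynomial of degree `m`, independent of the infinite-weight
variables, does not have weighted order `m + 1`. -/
lemma not_bigOwt_succ_of_homogeneous {r h m' : ℕ} {ℓ : Fin h → ℕ} {mm : Fin h → ℕ} {m : ℕ}
    {Q : MvPolynomial (HNIdx r h m' ℓ) ℂ} {f : HNV r h m' ℓ → ℂ}
    (hQ : ∀ x, f x = MvPolynomial.eval (fun i => (x i : ℂ)) Q)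
    (hdep : ∀ x y : HNV r h m' ℓ,
      (∀ i : Fin r ⊕ (Σ j : Fin h, Fin (ℓ j)), x (Sum.inl i) = y (Sum.inl i)) → f x = f y)
    (hfs : ContDiff ℝ (⊤ : ℕ∞) f)
    (hom : ∀ (τ : ℝ) (x : HNV r h m' ℓ), f (hndil mm τ x) = τ ^ m • f x) (hne : f ≠ 0) :
    ¬ FnBigOwt mm ((m : ℤ) + 1) f := by
  intro hO
  refine hne (funext fun x => ?_)
  rw [hQ, Pi.zero_apply]
  refine eval_ofReal_eq_zero_of_pdList (Q.totalDegree + 1) Q (fun s hs => ?_) (fun L => ?_) x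
  · exact MvPolynomial.coeff_eq_zero_of_totalDegree_lt (by
      rw [← Finsupp.degree_apply]; omega)
  · rw [← funext hQ]
    by_cases hL : wsum mm L = ⊤
    · rw [pdList_eq_zero_of_wsum_eq_top hfs hdep hL]
    obtain ⟨sw, hsw⟩ := ENat.ne_top_iff_exists.mp hL
    by_cases hm : sw = m
    · exact hO L sw hsw.symm (by omega)
    · exact pdList_zero_of_homogeneous hfs hom hsw.symm hm

/-- Theorem 2.3. In the Helffer–Nourrigat normalized setting, if the
weighted formal Taylor expansion of a germ `f` of a complex-valued smooth function at `0`
(with `wt(s′) = ∞`) has lowest nonzero weighted homogeneous term `f^{(m)}` of weighted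
degree `m` (so `f = f^{(m)} + O_wt(m+1)`), then `ν_𝒟(f)(0) = m`; and if `f = O_wt(d)` for
every `d`, then `ν_𝒟(f)(0) = ∞`. -/
theorem vanishOrder_eq_weight {r h m' : ℕ} {ℓ : Fin h → ℕ} {mm : Fin h → ℕ}
    (S : HNSetting r h m' ℓ mm)
    (f : HNV r h m' ℓ → ℂ) (hf : ContDiff ℝ (⊤ : ℕ∞) f) :
    (∀ (m : ℕ) (fm : HNV r h m' ℓ → ℂ),
      (∃ Q : MvPolynomial (HNIdx r h m' ℓ) ℂ,
        ∀ x, fm x = MvPolynomial.eval (fun i => (x i : ℂ)) Q) →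
      (∀ x y : HNV r h m' ℓ,
        (∀ i : Fin r ⊕ (Σ j : Fin h, Fin (ℓ j)), x (Sum.inl i) = y (Sum.inl i)) →
        fm x = fm y) →
      (∀ (τ : ℝ) (x : HNV r h m' ℓ), fm (hndil mm τ x) = (τ : ℂ) ^ m * fm x) →
      fm ≠ 0 →
      FnBigOwt mm ((m : ℤ) + 1) (fun x => f x - fm x) →
      vanishOrderHN S.X f 0 = (m : ℕ∞)) ∧
    ((∀ d : ℤ, FnBigOwt mm d f) → vanishOrderHN S.X f 0 = ⊤) := by
  refine ⟨fun m fm hpoly hdep hom hne hO => ?_, fun hO => ?_⟩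
  · obtain ⟨Q, hQ⟩ := hpoly
    have hfms : ContDiff ℝ (⊤ : ℕ∞) fm := by
      rw [funext hQ]
      exact MvPolynomial.contDiff_eval_comp contDiff_ofReal_coord Q
    have hom' : ∀ (τ : ℝ) (x : HNV r h m' ℓ), fm (hndil mm τ x) = τ ^ m • fm x := by
      intro τ x
      rw [hom, Complex.real_smul, Complex.ofReal_pow]
    have hfO : FnBigOwt mm m f := by
      simpa using (hO.mono (by omega)).add (.of_homogeneous hfms hom') (hf.sub hfms) hfms
    have hfv : ¬ WordsVanish S.X m f := by
      intro hfv
      have hsucc := S.bigOwt_succ_of_wordsVanish m f hf hfO hfv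
      refine not_bigOwt_succ_of_homogeneous hQ hdep hfms hom' hne ?_
      simpa using hsucc.sub hO hf (hf.sub hfms)
    refine le_antisymm (sInf_le ?_) (le_sInf ?_)
    · obtain ⟨Ys, hlen, hmem, hYs⟩ := exists_list_of_not_wordsVanish hfv
      exact ⟨Ys, by rw [hlen], hmem, hYs⟩
    · rintro _ ⟨Ys, rfl, hmem, hYs⟩
      by_contra! hlt
      exact hYs (S.foldl_vfApplyHN_eq_zero hf hfO hmem (by exact_mod_cast hlt))
  · refine le_antisymm le_top (le_sInf ?_)
    rintro _ ⟨Ys, rfl, hmem, hYs⟩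
    exact absurd (S.foldl_vfApplyHN_eq_zero hf (hO (Ys.length + 1)) hmem (by omega)) hYs
end

section
/- Assume the Helffer–Nourrigat normalized setting for X₁,…,X_r at p₀ = 0. Let L(x₁,…,x_r) = Σ_{j=1}^r a_j x_j be a nonzero linear function, and for real parameters t = (t_{j,q}) set Z = Σ_{j=0}^h Σ_{q=1}^{ℓ_j} (1/m_j) t_{j,q} L(x)^{m_j−1} Y_{j,q}, where Y_{0,q} = X_q, m₀ = 1 and ℓ₀ = r. Then for every germ f of a smooth function at 0 there is a proper real-analytic subset of the parameter space ℝ^{n₀} (n₀ = r + Σ_{j=1}^h ℓ_j) such that for every choice of t outside it, ν_𝒟(f)(0) = ν_Z(f)(0), where ν_Z(f)(0) is the smallest nonnegative integer ℓ with Z^ℓ(f)(0) ≠ 0, and ∞ if no such ℓ exists. -/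
open Topology

/-- The single vector field
`Z = Σ_{j=0}^h Σ_{q=1}^{ℓ_j} (1/m_j) t_{j,q} L(x)^{m_j−1} Y_{j,q}` built from the linear
function `L(x) = Σ_k a_k x_k` and the parameters `t`, where `Y_{0,q} = X_q`, `m₀ = 1`,
`ℓ₀ = r`. -/
noncomputable def ZField {r h m' : ℕ} {ℓ : Fin h → ℕ} {mm : Fin h → ℕ}
    (S : HNSetting r h m' ℓ mm) (a : Fin r → ℝ)
    (t : (Fin r ⊕ (Σ j : Fin h, Fin (ℓ j))) → ℝ) : HNV r h m' ℓ → HNV r h m' ℓ :=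
  fun p => (∑ q : Fin r, t (Sum.inl q) • S.X q p) +
    ∑ j : Fin h, ∑ q : Fin (ℓ j),
      ((1 / (mm j : ℝ)) * t (Sum.inr ⟨j, q⟩) *
        (∑ k : Fin r, a k * p (Sum.inl (Sum.inl k))) ^ (mm j - 1)) • S.Y j q p

/-- `ν_Z(f)(p)`: the smallest `k` with `Z^k(f)(p) ≠ 0`; `⊤` if no such `k` exists. -/
noncomputable def nuZ {r h m' : ℕ} {ℓ : Fin h → ℕ}
    (Z : HNV r h m' ℓ → HNV r h m' ℓ) (f : HNV r h m' ℓ → ℂ) (p : HNV r h m' ℓ) : ℕ∞ :=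
  sInf {m : ℕ∞ | ∃ k : ℕ, (k : ℕ∞) = m ∧ ((fun g => vfApplyHN Z g)^[k] f) p ≠ 0}

namespace HNOrder

section General

variable {E F I : Type*} [NormedAddCommGroup E] [NormedSpace ℝ E]
  [NormedAddCommGroup F] [NormedSpace ℝ F]

/-- The derivative of `f` along the vector field `V`. -/
noncomputable def lieD (V : E → E) (f : E → F) : E → F := fun x => fderiv ℝ f x (V x)

/-- The iterated derivative of `f` along a list of vector fields from the family `V`. -/
noncomputable def words (V : I → E → E) (L : List I) (f : E → F) : E → F :=
  L.foldl (fun g i => lieD (V i) g) f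

/-- All words of total weight `< d` in the weighted family `V` kill `f` at `p`. -/
def HasOrd (V : I → E → E) (w : I → ℕ∞) (p : E) (d : ℤ) (f : E → F) : Prop :=
  ∀ (L : List I) (n : ℕ), (L.map w).sum = (n : ℕ∞) → (n : ℤ) < d → words V L f p = 0

/-- Differentiation along `Y` shifts the order of functions at `p` by at least `c`. -/
def Lowers (V : I → E → E) (w : I → ℕ∞) (p : E) (c : ℤ) (Y : E → E) : Prop :=
  ∀ (e : ℤ) (g : E → ℂ), ContDiff ℝ (⊤ : ℕ∞) g → HasOrd V w p e g →
    HasOrd V w p (e + c) (lieD Y g)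

lemma _root_.ContDiff.lieD {V : E → E} {f : E → F} (hV : ContDiff ℝ (⊤ : ℕ∞) V)
    (hf : ContDiff ℝ (⊤ : ℕ∞) f) : ContDiff ℝ (⊤ : ℕ∞) (lieD V f) :=
  (hf.fderiv_right (m := (⊤ : ℕ∞)) (by simp)).clm_apply hV

lemma differentiable {f : E → F} (hf : ContDiff ℝ (⊤ : ℕ∞) f) : Differentiable ℝ f :=
  hf.differentiable (by simp)

lemma contDiff_iterate_lieD {V : E → E} (hV : ContDiff ℝ (⊤ : ℕ∞) V) (n : ℕ) {f : E → F}
    (hf : ContDiff ℝ (⊤ : ℕ∞) f) : ContDiff ℝ (⊤ : ℕ∞) ((lieD V)^[n] f) := by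
  induction n generalizing f with
  | zero => exact hf
  | succ n ih => exact ih (hV.lieD hf)

lemma lieD_add (V : E → E) {f g : E → F} (hf : ContDiff ℝ (⊤ : ℕ∞) f)
    (hg : ContDiff ℝ (⊤ : ℕ∞) g) : lieD V (f + g) = lieD V f + lieD V g := by
  ext x
  simp [lieD, fderiv_add (differentiable hf x) (differentiable hg x)]

lemma lieD_smul (V : E → E) {u : E → ℝ} {f : E → F} (hu : ContDiff ℝ (⊤ : ℕ∞) u)
    (hf : ContDiff ℝ (⊤ : ℕ∞) f) :
    lieD V (fun x => u x • f x) =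
      (fun x => u x • lieD V f x) + fun x => lieD V u x • f x := by
  ext x
  have := fderiv_fun_smul (differentiable hu x) (differentiable hf x)
  simp [lieD, this]

lemma contDiff_linear_comb {ι : Type*} [Fintype ι] (c : ι → ℝ) {g : ι → E → F}
    (hg : ∀ i, ContDiff ℝ (⊤ : ℕ∞) (g i)) : ContDiff ℝ (⊤ : ℕ∞) fun x => ∑ i, c i • g i x :=
  ContDiff.sum fun i _ => contDiff_const.smul (hg i)

lemma lieD_linear_comb {ι : Type*} [Fintype ι] (V : E → E) (c : ι → ℝ) {g : ι → E → F}
    (hg : ∀ i, ContDiff ℝ (⊤ : ℕ∞) (g i)) :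
    lieD V (fun x => ∑ i, c i • g i x) = fun x => ∑ i, c i • lieD V (g i) x := by
  ext x
  have h : ∀ i, DifferentiableAt ℝ (fun y => c i • g i y) x := fun i =>
    (differentiable (hg i) x).const_smul (c i)
  simp only [lieD]
  rw [fderiv_fun_sum fun i _ => h i]
  simp [fderiv_fun_const_smul (differentiable (hg _) x)]

lemma iterate_lieD_linear_comb {ι : Type*} [Fintype ι] {V : E → E}
    (hV : ContDiff ℝ (⊤ : ℕ∞) V) (n : ℕ) (c : ι → ℝ) {g : ι → E → F}
    (hg : ∀ i, ContDiff ℝ (⊤ : ℕ∞) (g i)) :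
    (lieD V)^[n] (fun x => ∑ i, c i • g i x) =
      fun x => ∑ i, c i • (lieD V)^[n] (g i) x := by
  induction n generalizing g with
  | zero => rfl
  | succ n ih =>
    simp only [Function.iterate_succ, Function.comp_apply]
    rw [lieD_linear_comb V c hg, ih fun i => hV.lieD (hg i)]

lemma lieD_comm_sub {X Y : E → E} {f : E → F} (hX : ContDiff ℝ (⊤ : ℕ∞) X)
    (hY : ContDiff ℝ (⊤ : ℕ∞) Y) (hf : ContDiff ℝ (⊤ : ℕ∞) f) :
    lieD (fun p => fderiv ℝ Y p (X p) - fderiv ℝ X p (Y p)) f =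
      lieD X (lieD Y f) - lieD Y (lieD X f) := by
  ext x
  have h1 : Differentiable ℝ (fderiv ℝ f) :=
    differentiable (hf.fderiv_right (m := (⊤ : ℕ∞)) (by simp))
  have hs : IsSymmSndFDerivAt ℝ f x := by
    refine (hf.contDiffAt).isSymmSndFDerivAt ?_
    rw [minSmoothness_of_isRCLikeNormedField]
    exact WithTop.coe_le_coe.2 (le_top : (2 : ℕ∞) ≤ ⊤)
  have e1 : ∀ {W : E → E}, ContDiff ℝ (⊤ : ℕ∞) W → fderiv ℝ (fun y => fderiv ℝ f y (W y)) x =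
      _ := fun {W} hW => fderiv_clm_apply (h1 x) (differentiable hW x)
  change fderiv ℝ f x _ = fderiv ℝ (fun y => fderiv ℝ f y (Y y)) x (X x) -
    fderiv ℝ (fun y => fderiv ℝ f y (X y)) x (Y x)
  rw [e1 hY, e1 hX]
  simp [hs.eq (X x) (Y x)]

lemma lieD_const_comm (v w : E) {f : E → F} (hf : ContDiff ℝ (⊤ : ℕ∞) f) :
    lieD (fun _ => v) (lieD (fun _ => w) f) = lieD (fun _ => w) (lieD (fun _ => v) f) := by
  have := lieD_comm_sub (X := fun _ : E => v) (Y := fun _ => w) contDiff_const contDiff_const hf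
  have h0 : lieD (fun p : E => fderiv ℝ (fun _ : E => w) p v - fderiv ℝ (fun _ : E => v) p w) f
      = 0 := by
    ext x; simp [lieD]
  rw [h0] at this
  exact sub_eq_zero.mp this.symm

variable {V : I → E → E} {w : I → ℕ∞} {p : E}

lemma words_add (hV : ∀ i, ContDiff ℝ (⊤ : ℕ∞) (V i)) (L : List I) {f g : E → F}
    (hf : ContDiff ℝ (⊤ : ℕ∞) f) (hg : ContDiff ℝ (⊤ : ℕ∞) g) :
    words V L (f + g) = words V L f + words V L g := by
  induction L generalizing f g with
  | nil => rfl
  | cons i L ih =>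
    change words V L (lieD (V i) (f + g)) = _
    rw [lieD_add _ hf hg, ih ((hV i).lieD hf) ((hV i).lieD hg)]
    rfl

lemma contDiff_words (hV : ∀ i, ContDiff ℝ (⊤ : ℕ∞) (V i)) (L : List I) {f : E → F}
    (hf : ContDiff ℝ (⊤ : ℕ∞) f) : ContDiff ℝ (⊤ : ℕ∞) (words V L f) := by
  induction L generalizing f with
  | nil => exact hf
  | cons i L ih => exact ih ((hV i).lieD hf)

lemma words_const_smul (hV : ∀ i, ContDiff ℝ (⊤ : ℕ∞) (V i)) (L : List I) (c : ℝ) {f : E → F}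
    (hf : ContDiff ℝ (⊤ : ℕ∞) f) :
    words V L (fun x => c • f x) = fun x => c • words V L f x := by
  induction L generalizing f with
  | nil => rfl
  | cons i L ih =>
    change words V L (lieD (V i) _) = _
    rw [show lieD (V i) (fun x => c • f x) = fun x => c • lieD (V i) f x by
      ext x; simp [lieD, fderiv_fun_const_smul (differentiable hf x)], ih ((hV i).lieD hf)]
    rfl

lemma words_zero (V : I → E → E) (L : List I) : words V L (0 : E → F) = 0 := by
  induction L with
  | nil => rfl
  | cons i L ih =>
    change words V L (lieD (V i) 0) = 0
    rwa [show lieD (V i) (0 : E → F) = 0 by ext x; simp [lieD]]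

lemma HasOrd.mono {d e : ℤ} {f : E → F} (hf : HasOrd V w p d f) (h : e ≤ d) :
    HasOrd V w p e f := fun L n hn hlt => hf L n hn (hlt.trans_le h)

lemma hasOrd_zero_fun (d : ℤ) : HasOrd V w p d (0 : E → F) := fun L _ _ _ => by
  rw [words_zero]; rfl

lemma hasOrd_of_nonpos {d : ℤ} (hd : d ≤ 0) (f : E → F) : HasOrd V w p d f :=
  fun L n _ h => by omega

lemma HasOrd.apply_eq_zero {d : ℤ} (hd : 0 < d) {f : E → F} (hf : HasOrd V w p d f) :
    f p = 0 := hf [] 0 (by simp) (by simpa using hd)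

lemma hasOrd_one (hw : ∀ i, w i ≠ 0) {f : E → F} (hf : f p = 0) : HasOrd V w p 1 f := by
  intro L n hn hlt
  obtain rfl : n = 0 := by omega
  cases L with
  | nil => exact hf
  | cons i L => simp [hw i] at hn

lemma HasOrd.add (hV : ∀ i, ContDiff ℝ (⊤ : ℕ∞) (V i)) {d : ℤ} {f g : E → F}
    (hfs : ContDiff ℝ (⊤ : ℕ∞) f) (hgs : ContDiff ℝ (⊤ : ℕ∞) g)
    (hf : HasOrd V w p d f) (hg : HasOrd V w p d g) : HasOrd V w p d (f + g) := by
  intro L n hn hlt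
  rw [words_add hV L hfs hgs]
  simp [hf L n hn hlt, hg L n hn hlt]

lemma HasOrd.sum (hV : ∀ i, ContDiff ℝ (⊤ : ℕ∞) (V i)) {ι : Type*} (s : Finset ι) {d : ℤ}
    {f : ι → E → F} (hfs : ∀ i, ContDiff ℝ (⊤ : ℕ∞) (f i))
    (hf : ∀ i ∈ s, HasOrd V w p d (f i)) : HasOrd V w p d (fun x => ∑ i ∈ s, f i x) := by
  classical
  induction s using Finset.induction_on with
  | empty => exact hasOrd_zero_fun d
  | insert i s hi ih =>
    simp only [Finset.sum_insert hi]
    exact HasOrd.add hV (hfs i) (ContDiff.sum fun j _ => hfs j) (hf i (by simp))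
      (ih fun j hj => hf j (by simp [hj]))

lemma HasOrd.lieD_word {d : ℤ} {f : E → F} (hf : HasOrd V w p d f) {i : I} {k : ℕ}
    (hk : w i = k) : HasOrd V w p (d - k) (lieD (V i) f) := by
  intro L n hn hlt
  refine hf (i :: L) (k + n) (by simp [hk, hn]) (by push_cast; omega)

lemma HasOrd.smul (hV : ∀ i, ContDiff ℝ (⊤ : ℕ∞) (V i)) {d e : ℤ} {u : E → ℝ} {f : E → F}
    (hus : ContDiff ℝ (⊤ : ℕ∞) u) (hfs : ContDiff ℝ (⊤ : ℕ∞) f)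
    (hu : HasOrd V w p d u) (hf : HasOrd V w p e f) :
    HasOrd V w p (d + e) (fun x => u x • f x) := by
  intro L
  induction L generalizing d e u f with
  | nil =>
    intro n hn hlt
    change u p • f p = 0
    rcases (by omega : 0 < d ∨ 0 < e) with h | h
    · simp [hu.apply_eq_zero h]
    · simp [hf.apply_eq_zero h]
  | cons i L ih =>
    intro n hn hlt
    change words V L (lieD (V i) _) p = 0
    rw [List.map_cons, List.sum_cons] at hn
    obtain ⟨k, hk⟩ := ENat.ne_top_iff_exists.mp
      (show w i ≠ ⊤ from fun h => by simp [h] at hn)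
    obtain ⟨l, hl⟩ := ENat.ne_top_iff_exists.mp
      (show (L.map w).sum ≠ ⊤ from fun h => by simp [h] at hn)
    have hkl : k + l = n := by rw [← hk, ← hl] at hn; exact_mod_cast hn
    rw [lieD_smul _ hus hfs, words_add hV L (f := fun x => u x • lieD (V i) f x)
      (g := fun x => lieD (V i) u x • f x) (hus.smul ((hV i).lieD hfs))
      (((hV i).lieD hus).smul hfs), Pi.add_apply,
      ih hus ((hV i).lieD hfs) hu (hf.lieD_word hk.symm) l hl.symm (by omega),
      ih ((hV i).lieD hus) hfs (hu.lieD_word hk.symm) hf l hl.symm (by omega), add_zero]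

lemma HasOrd.pow (hV : ∀ i, ContDiff ℝ (⊤ : ℕ∞) (V i)) {u : E → ℝ}
    (hus : ContDiff ℝ (⊤ : ℕ∞) u) (hu : HasOrd V w p 1 u) (n : ℕ) :
    HasOrd V w p n (fun x => u x ^ n) := by
  induction n with
  | zero => exact hasOrd_of_nonpos (by simp) _
  | succ n ih =>
    have := HasOrd.smul hV (hus.pow n) hus ih hu
    simpa [pow_succ] using this

lemma Lowers.mono {c d : ℤ} {Y : E → E} (hY : Lowers V w p c Y) (h : d ≤ c) :
    Lowers V w p d Y := fun e g hg ho => (hY e g hg ho).mono (by omega)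

lemma lowers_word {i : I} {k : ℕ} (hk : w i = k) : Lowers V w p (-k) (V i) :=
  fun _ _ _ ho => ho.lieD_word hk

lemma Lowers.smul (hV : ∀ i, ContDiff ℝ (⊤ : ℕ∞) (V i)) {c d : ℤ} {u : E → ℝ} {Y : E → E}
    (hus : ContDiff ℝ (⊤ : ℕ∞) u) (hYs : ContDiff ℝ (⊤ : ℕ∞) Y)
    (hu : HasOrd V w p d u) (hY : Lowers V w p c Y) :
    Lowers V w p (d + c) (fun x => u x • Y x) := by
  intro e g hg ho
  have := HasOrd.smul hV hus (hYs.lieD hg) hu (hY e g hg ho)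
  rw [show d + (e + c) = e + (d + c) by ring] at this
  convert this using 2
  simp [lieD]

lemma Lowers.smul_of_eq (hV : ∀ i, ContDiff ℝ (⊤ : ℕ∞) (V i)) {b c d : ℤ} {u : E → ℝ}
    {Y : E → E} (hus : ContDiff ℝ (⊤ : ℕ∞) u) (hYs : ContDiff ℝ (⊤ : ℕ∞) Y)
    (hu : HasOrd V w p d u) (hY : Lowers V w p c Y) (h : b = d + c) :
    Lowers V w p b (fun x => u x • Y x) := h ▸ Lowers.smul hV hus hYs hu hY

lemma Lowers.add (hV : ∀ i, ContDiff ℝ (⊤ : ℕ∞) (V i)) {c : ℤ} {X Y : E → E}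
    (hXs : ContDiff ℝ (⊤ : ℕ∞) X) (hYs : ContDiff ℝ (⊤ : ℕ∞) Y)
    (hX : Lowers V w p c X) (hY : Lowers V w p c Y) :
    Lowers V w p c (fun x => X x + Y x) := by
  intro e g hg ho
  convert HasOrd.add hV (hXs.lieD hg) (hYs.lieD hg) (hX e g hg ho) (hY e g hg ho) using 1
  ext x; simp [lieD]

lemma Lowers.sum (hV : ∀ i, ContDiff ℝ (⊤ : ℕ∞) (V i)) {ι : Type*} (s : Finset ι) {c : ℤ}
    {Y : ι → E → E} (hYs : ∀ i, ContDiff ℝ (⊤ : ℕ∞) (Y i))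
    (hY : ∀ i ∈ s, Lowers V w p c (Y i)) : Lowers V w p c (fun x => ∑ i ∈ s, Y i x) := by
  intro e g hg ho
  convert HasOrd.sum hV s (fun i => (hYs i).lieD hg) (fun i hi => hY i hi e g hg ho) using 1
  ext x; simp [lieD]

lemma Lowers.linear_comb (hV : ∀ i, ContDiff ℝ (⊤ : ℕ∞) (V i)) {ι : Type*} [Fintype ι]
    {c : ℤ} {Y : ι → E → E} (hYs : ∀ i, ContDiff ℝ (⊤ : ℕ∞) (Y i))
    (hY : ∀ i, Lowers V w p c (Y i)) (t : ι → ℝ) :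
    Lowers V w p c (fun x => ∑ i, t i • Y i x) :=
  Lowers.sum hV _ (fun i => contDiff_const.smul (hYs i)) fun i _ =>
    Lowers.smul_of_eq hV contDiff_const (hYs i) (hasOrd_of_nonpos le_rfl _) (hY i)
      (zero_add c).symm

lemma Lowers.bracket (hV : ∀ i, ContDiff ℝ (⊤ : ℕ∞) (V i)) {c d : ℤ} {X Y : E → E}
    (hXs : ContDiff ℝ (⊤ : ℕ∞) X) (hYs : ContDiff ℝ (⊤ : ℕ∞) Y)
    (hX : Lowers V w p c X) (hY : Lowers V w p d Y) :
    Lowers V w p (d + c) (fun p => fderiv ℝ Y p (X p) - fderiv ℝ X p (Y p)) := by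
  intro e g hg ho
  have hXY := hX _ _ (hYs.lieD hg) (hY e g hg ho)
  have hYX := hY _ _ (hXs.lieD hg) (hX e g hg ho)
  rw [lieD_comm_sub hXs hYs hg]
  have hn : HasOrd V w p (e + (d + c)) (-lieD Y (lieD X g)) := by
    have := HasOrd.smul hV (contDiff_const (c := (-1 : ℝ))) (hYs.lieD (hXs.lieD hg))
      (hasOrd_of_nonpos le_rfl _) hYX
    rw [show 0 + (e + c + d) = e + (d + c) by ring] at this
    convert this using 1
    ext x; simp
  rw [sub_eq_add_neg]
  exact HasOrd.add hV (hXs.lieD (hYs.lieD hg)) (hYs.lieD (hXs.lieD hg)).neg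
    (hXY.mono (by omega)) hn

lemma Lowers.iterate {Z : E → E} (hZs : ContDiff ℝ (⊤ : ℕ∞) Z) (hZ : Lowers V w p (-1) Z)
    (n : ℕ) {e : ℤ} {g : E → ℂ} (hg : ContDiff ℝ (⊤ : ℕ∞) g) (ho : HasOrd V w p e g) :
    HasOrd V w p (e - n) ((lieD Z)^[n] g) := by
  induction n generalizing e g with
  | zero => simpa using ho
  | succ n ih =>
    exact (ih (hZs.lieD hg) (hZ e g hg ho)).mono (by push_cast; omega)

/-- Two fields of degree `-1` with the same leading part agree to leading order. -/
lemma iterate_lieD_eq (hV : ∀ i, ContDiff ℝ (⊤ : ℕ∞) (V i)) {Z Z₀ : E → E}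
    (hZs : ContDiff ℝ (⊤ : ℕ∞) Z) (hZ₀s : ContDiff ℝ (⊤ : ℕ∞) Z₀)
    (hZ : Lowers V w p (-1) Z) (hZ₀ : Lowers V w p (-1) Z₀)
    (hR : Lowers V w p 0 (fun x => Z x - Z₀ x)) (n : ℕ) {f g : E → ℂ}
    (hf : ContDiff ℝ (⊤ : ℕ∞) f) (hg : ContDiff ℝ (⊤ : ℕ∞) g) (hfo : HasOrd V w p n f)
    (hfg : HasOrd V w p (n + 1) (f - g)) :
    (lieD Z)^[n] f p = (lieD Z₀)^[n] g p := by
  induction n generalizing f g with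
  | zero => exact sub_eq_zero.mp (hfg.apply_eq_zero (by simp))
  | succ n ih =>
    refine ih (hZs.lieD hf) (hZ₀s.lieD hg) ((hZ _ _ hf hfo).mono (by push_cast; omega)) ?_
    have h1 : HasOrd V w p (n + 1) (lieD Z₀ (f - g)) :=
      (hZ₀ _ _ (hf.sub hg) hfg).mono (by push_cast; omega)
    have h2 : HasOrd V w p (n + 1) (lieD (fun x => Z x - Z₀ x) f) :=
      (hR _ _ hf hfo).mono (by push_cast; omega)
    convert HasOrd.add hV (hZ₀s.lieD (hf.sub hg)) ((hZs.sub hZ₀s).lieD hf) h1 h2 using 1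
    ext x
    simp [lieD, fderiv_fun_sub (differentiable hf x) (differentiable hg x)]

/-- Derivatives of a function along an integral curve. -/
lemma iterate_deriv_comp_curve {Z : E → E} (hZs : ContDiff ℝ (⊤ : ℕ∞) Z) {γ : ℝ → E}
    (hγ : ∀ τ, HasDerivAt γ (Z (γ τ)) τ) (n : ℕ) {g : E → F} (hg : ContDiff ℝ (⊤ : ℕ∞) g) :
    deriv^[n] (fun τ => g (γ τ)) = fun τ => (lieD Z)^[n] g (γ τ) := by
  induction n generalizing g with
  | zero => rfl
  | succ n ih =>
    simp only [Function.iterate_succ, Function.comp_apply]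
    rw [← ih (hZs.lieD hg)]
    congr 1
    ext τ
    exact ((differentiable hg (γ τ)).hasFDerivAt.comp_hasDerivAt τ (hγ τ)).deriv

lemma analyticOnNhd_iterate_lieD {ι : Type*} [Fintype ι] {W : ι → E → E}
    (hW : ∀ i, ContDiff ℝ (⊤ : ℕ∞) (W i)) (n : ℕ) {g : E → F}
    (hg : ContDiff ℝ (⊤ : ℕ∞) g) (p : E) :
    AnalyticOnNhd ℝ (fun t : ι → ℝ => (lieD fun x => ∑ i, t i • W i x)^[n] g p)
      Set.univ := by
  induction n generalizing g with
  | zero => exact analyticOnNhd_const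
  | succ n ih =>
    have key : (fun t : ι → ℝ => (lieD fun x => ∑ i, t i • W i x)^[n + 1] g p) =
        fun t => ∑ i, t i • (lieD fun x => ∑ i, t i • W i x)^[n] (lieD (W i) g) p := by
      ext t
      have h : lieD (fun x => ∑ i, t i • W i x) g = fun x => ∑ i, t i • lieD (W i) g x := by
        ext x; simp [lieD]
      rw [Function.iterate_succ, Function.comp_apply, h, iterate_lieD_linear_comb
        (V := fun x => ∑ i, t i • W i x) (contDiff_linear_comb t hW) n t fun i => (hW i).lieD hg]
    rw [key]
    refine Finset.analyticOnNhd_fun_sum _ fun i _ => ?_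
    exact AnalyticOnNhd.smul
      ((ContinuousLinearMap.proj (R := ℝ) (φ := fun _ : ι => ℝ) i).analyticOnNhd _)
      (ih ((hW i).lieD hg))

lemma iterate_deriv_pow_smul (n : ℕ) (v : F) :
    deriv^[n] (fun τ : ℝ => τ ^ n • v) = fun _ => (n.factorial : ℝ) • v := by
  induction n generalizing v with
  | zero => simp
  | succ n ih =>
    have h : deriv (fun τ : ℝ => τ ^ (n + 1) • v) = fun τ => τ ^ n • (((n : ℝ) + 1) • v) := by
      ext τ
      rw [deriv_smul_const (by fun_prop)]
      simp [smul_smul, mul_comm]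
    rw [Function.iterate_succ, Function.comp_apply, h, ih]
    simp [Nat.factorial_succ, smul_smul, mul_comm]

end General

/-- Solvability of triangular linear systems with nonzero diagonal. -/
lemma exists_triangular_solution {ι : Type*} [Fintype ι] (rk : ι → ℕ) (D B : ι → ℝ)
    (hD : ∀ s, D s ≠ 0) (M : ι → ι → ℝ) (hM : ∀ s' s, ¬ rk s' < rk s → M s' s = 0) :
    ∃ T : ι → ℝ, ∀ s, T s * D s + ∑ s', T s' * M s' s = B s := by
  have key : ∀ n : ℕ, ∃ T : ι → ℝ, ∀ s, rk s < n →
      T s * D s + ∑ s', T s' * M s' s = B s := by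
    intro n
    induction n with
    | zero => exact ⟨0, fun s hs => absurd hs (by simp)⟩
    | succ n ih =>
      obtain ⟨T, hT⟩ := ih
      let T' : ι → ℝ := fun s =>
        if rk s < n then T s else (B s - ∑ s', T s' * M s' s) / D s
      have hsum : ∀ s, rk s < n + 1 → ∑ s', T' s' * M s' s = ∑ s', T s' * M s' s := by
        intro s hs
        refine Finset.sum_congr rfl fun s' _ => ?_
        by_cases h : rk s' < rk s
        · simp [T', show rk s' < n by omega]
        · simp [hM s' s h]
      refine ⟨T', fun s hs => ?_⟩
      rw [hsum s hs]
      by_cases h : rk s < n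
      · simpa [T', h] using hT s h
      · simp only [T', h, if_false]
        rw [div_mul_cancel₀ _ (hD s)]
        ring
  obtain ⟨T, hT⟩ := key (Finset.univ.sup rk + 1)
  exact ⟨T, fun s => hT s (Nat.lt_succ_of_le (Finset.le_sup (Finset.mem_univ s)))⟩

section Setting

variable {r h m' : ℕ} {ℓ : Fin h → ℕ} {mm : Fin h → ℕ}

/-- The coordinate vector fields. -/
def coordField (i : HNIdx r h m' ℓ) : HNV r h m' ℓ → HNV r h m' ℓ := fun _ => hnb i

lemma contDiff_coordField (i : HNIdx r h m' ℓ) :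
    ContDiff ℝ (⊤ : ℕ∞) (coordField i) := contDiff_const

lemma lieD_eq_sum (Y : HNV r h m' ℓ → HNV r h m' ℓ) (g : HNV r h m' ℓ → ℂ) :
    lieD Y g = fun x => ∑ i, Y x i • lieD (coordField i) g x := by
  ext x
  have h : Y x = ∑ i, Y x i • (Pi.single i 1 : HNV r h m' ℓ) := by
    simpa using (Pi.basisFun ℝ (HNIdx r h m' ℓ)).sum_repr (Y x) |>.symm
  simp only [lieD]
  conv_lhs => rw [h]
  simp [coordField, hnb]

lemma lowers_of_vfBigOwt {c : ℤ} {Y : HNV r h m' ℓ → HNV r h m' ℓ}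
    (hYs : ContDiff ℝ (⊤ : ℕ∞) Y) (hY : VfBigOwt mm c Y) :
    Lowers coordField (hnwt mm) 0 c Y := by
  intro e g hg ho
  have hYi : ∀ i, ContDiff ℝ (⊤ : ℕ∞) fun x => Y x i := contDiff_pi.mp hYs
  have hgi : ∀ i, ContDiff ℝ (⊤ : ℕ∞) (lieD (coordField i) g) :=
    fun i => (contDiff_coordField i).lieD hg
  rw [lieD_eq_sum]
  refine HasOrd.sum contDiff_coordField _ (fun i => (hYi i).smul (hgi i)) fun i _ => ?_
  by_cases hi : hnwt mm i = ⊤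
  · exact (HasOrd.smul contDiff_coordField (hYi i) (hgi i) (hY.2 i hi (e + c))
      (hasOrd_of_nonpos le_rfl _)).mono (by simp)
  · obtain ⟨k, hk⟩ := ENat.ne_top_iff_exists.mp hi
    exact (HasOrd.smul contDiff_coordField (hYi i) (hgi i) (hY.1 i k hk.symm)
      (ho.lieD_word hk.symm)).mono (by omega)

lemma words_comp_diag {F : Type*} [NormedAddCommGroup F] [NormedSpace ℝ F]
    (α : HNIdx r h m' ℓ → ℝ) (L : List (HNIdx r h m' ℓ)) {f : HNV r h m' ℓ → F}
    (hf : ContDiff ℝ (⊤ : ℕ∞) f) :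
    words coordField L (fun y => f fun i => α i * y i) =
      fun x => (L.map α).prod • words coordField L f fun i => α i * x i := by
  induction L generalizing f with
  | nil => ext x; simp [words]
  | cons i L ih =>
    have hstep : lieD (coordField i) (fun y => f fun i => α i * y i) =
        fun x => (fun z => α i • lieD (coordField i) f z) fun i => α i * x i := by
      ext x
      let A : HNV r h m' ℓ →L[ℝ] HNV r h m' ℓ :=
        ContinuousLinearMap.pi fun i => α i • ContinuousLinearMap.proj i
      have hA : HasFDerivAt (fun y : HNV r h m' ℓ => fun i => α i * y i) A x := A.hasFDerivAt
      have hv : A (hnb i) = α i • hnb i := by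
        ext k
        by_cases hk : k = i
        · subst hk; simp [A, hnb]
        · simp [A, hnb, hk]
      simp only [lieD, coordField]
      have hc : HasFDerivAt (fun y : HNV r h m' ℓ => f fun i => α i * y i)
          ((fderiv ℝ f fun i => α i * x i).comp A) x :=
        (differentiable hf _).hasFDerivAt.comp x hA
      rw [hc.fderiv]
      simp [hv]
    change words coordField L (lieD (coordField i) _) = _
    rw [hstep, ih (f := fun z => α i • lieD (coordField i) f z)
      (contDiff_const.smul ((contDiff_coordField i).lieD hf)),
      words_const_smul contDiff_coordField L _ ((contDiff_coordField i).lieD hf)]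
    ext x
    simp only [List.map_cons, List.prod_cons, smul_smul]
    rw [mul_comm]
    rfl

lemma prod_map_eq_pow {α : HNIdx r h m' ℓ → ℝ} {τ : ℝ}
    (hα : ∀ i (k : ℕ), hnwt mm i = (k : ℕ∞) → α i = τ ^ k) (L : List (HNIdx r h m' ℓ)) (n : ℕ)
    (hn : (L.map (hnwt mm)).sum = (n : ℕ∞)) : (L.map α).prod = τ ^ n := by
  induction L generalizing n with
  | nil =>
    obtain rfl : n = 0 := by simpa [eq_comm] using hn
    simp
  | cons i L ih =>
    rw [List.map_cons, List.sum_cons] at hn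
    obtain ⟨k, hk⟩ := ENat.ne_top_iff_exists.mp
      (show hnwt mm i ≠ ⊤ from fun h => by simp [h] at hn)
    obtain ⟨l, hl⟩ := ENat.ne_top_iff_exists.mp
      (show (L.map (hnwt mm)).sum ≠ ⊤ from fun h => by simp [h] at hn)
    have hkl : k + l = n := by rw [← hk, ← hl] at hn; exact_mod_cast hn
    rw [List.map_cons, List.prod_cons, hα i k hk.symm, ih l hl.symm, ← pow_add, hkl]

lemma hasOrd_of_wHomog {d : ℕ} {P : HNV r h m' ℓ → ℝ} (hPs : ContDiff ℝ (⊤ : ℕ∞) P)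
    (hP : WHomog mm d P) : HasOrd coordField (hnwt mm) 0 d P := by
  intro L n hn hlt
  let α : HNIdx r h m' ℓ → ℝ := fun i => match i with
    | .inl (.inl _) => 2
    | .inl (.inr s) => 2 ^ mm s.1
    | .inr _ => 1
  have hdil : ∀ x : HNV r h m' ℓ, hndil mm 2 x = fun i => α i * x i := by
    intro x; ext i
    rcases i with (i | i) | i <;> simp [hndil, α]
  have hα : ∀ i (k : ℕ), hnwt mm i = (k : ℕ∞) → α i = 2 ^ k := by
    rintro ((i | i) | i) k hk
    · obtain rfl : 1 = k := by
        change (1 : ℕ∞) = k at hk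
        exact_mod_cast hk
      simp [α]
    · obtain rfl : mm i.1 = k := by simpa [hnwt] using hk
      rfl
    · simp [hnwt] at hk
  have h1 := congrFun (words_comp_diag α L hPs) 0
  have h2 : (fun y => P fun i => α i * y i) = fun y => (2 : ℝ) ^ d • P y := by
    ext y; rw [← hdil, hP]; rfl
  rw [h2, words_const_smul contDiff_coordField L _ hPs, prod_map_eq_pow hα L n hn] at h1
  simp only [Pi.zero_apply, mul_zero, smul_eq_mul] at h1
  have h3 : (2 : ℝ) ^ n < 2 ^ d := pow_lt_pow_right₀ (by norm_num) (by exact_mod_cast hlt)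
  change (2 : ℝ) ^ d * words coordField L P 0 = 2 ^ n * words coordField L P 0 at h1
  exact (mul_eq_mul_right_iff.mp h1).resolve_left h3.ne'

lemma contDiff_of_isPolyFn {P : HNV r h m' ℓ → ℝ} (hP : IsPolyFn P) :
    ContDiff ℝ (⊤ : ℕ∞) P := by
  obtain ⟨Q, hQ⟩ := hP
  rw [show P = fun x => MvPolynomial.eval x Q from funext hQ]
  clear hQ
  induction Q using MvPolynomial.induction_on with
  | C a => simpa using contDiff_const
  | add p q hp hq => simpa using hp.add hq
  | mul_X p i hp => simpa using hp.mul (contDiff_apply ℝ ℝ i)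

/-- The linear function `L(x) = Σ_k a_k x_k`. -/
def linForm (a : Fin r → ℝ) (p : HNV r h m' ℓ) : ℝ := ∑ k : Fin r, a k * p (Sum.inl (Sum.inl k))

lemma contDiff_linForm (a : Fin r → ℝ) :
    ContDiff ℝ (⊤ : ℕ∞) (linForm a : HNV r h m' ℓ → ℝ) :=
  ContDiff.sum fun _ _ => contDiff_const.mul (contDiff_apply ℝ ℝ _)

variable (S : HNSetting r h m' ℓ mm) (a : Fin r → ℝ)

/-- The coefficient `(1/m_j) L^{m_j-1}`. -/
noncomputable def coeff (mm : Fin h → ℕ) (j : Fin h) (p : HNV r h m' ℓ) : ℝ :=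
  (1 / (mm j : ℝ)) * linForm a p ^ (mm j - 1)

lemma contDiff_coeff (j : Fin h) :
    ContDiff ℝ (⊤ : ℕ∞) (coeff a mm j : HNV r h m' ℓ → ℝ) :=
  contDiff_const.mul ((contDiff_linForm a).pow _)

/-- The fields `X_q` and `(1/m_j) L^{m_j-1} Y_{j,q}`, whose combinations are the `Z`. -/
noncomputable def field : (Fin r ⊕ (Σ j : Fin h, Fin (ℓ j))) → HNV r h m' ℓ → HNV r h m' ℓ
  | .inl q => S.X q
  | .inr s => fun p => coeff a mm s.1 p • S.Y s.1 s.2 p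

/-- The leading part of `X_q`. -/
noncomputable def leadX (k : Fin r) (x : HNV r h m' ℓ) : HNV r h m' ℓ :=
  hnb (Sum.inl (Sum.inl k)) +
    ∑ j : Fin h, ∑ q : Fin (ℓ j), S.P k j q x • hnb (Sum.inl (Sum.inr ⟨j, q⟩))

/-- The leading part of `Y_{k,j}`. -/
noncomputable def leadY (k : Fin h) (j : Fin (ℓ k)) (x : HNV r h m' ℓ) : HNV r h m' ℓ :=
  hnb (Sum.inl (Sum.inr ⟨k, j⟩)) + ∑ τ : Fin h, ∑ q : Fin (ℓ τ),
    (if k < τ then S.Q k j τ q x else 0) • hnb (Sum.inl (Sum.inr ⟨τ, q⟩))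

/-- The leading parts of the fields `field S a`. -/
noncomputable def leadField :
    (Fin r ⊕ (Σ j : Fin h, Fin (ℓ j))) → HNV r h m' ℓ → HNV r h m' ℓ
  | .inl q => leadX S q
  | .inr s => fun p => coeff a mm s.1 p • leadY S s.1 s.2 p

lemma zField_eq (t : (Fin r ⊕ (Σ j : Fin h, Fin (ℓ j))) → ℝ) :
    ZField S a t = fun p => ∑ s, t s • field S a s p := by
  ext p : 1
  rw [Fintype.sum_sum_type, Fintype.sum_sigma]
  simp only [ZField, field, coeff, linForm, smul_smul]
  congr 1
  refine Finset.sum_congr rfl fun j _ => Finset.sum_congr rfl fun q _ => ?_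
  congr 1
  ring

lemma contDiff_of_isIterComm {X : Fin r → HNV r h m' ℓ → HNV r h m' ℓ}
    (hX : ∀ k, ContDiff ℝ (⊤ : ℕ∞) (X k)) {μ : ℕ} {Z : HNV r h m' ℓ → HNV r h m' ℓ}
    (hZ : IsIterComm X μ Z) : ContDiff ℝ (⊤ : ℕ∞) Z := by
  induction hZ with
  | base k => exact hX k
  | step k _ ih =>
    exact (ContDiff.lieD (hX k) ih).sub (ContDiff.lieD ih (hX k))

lemma lowers_of_isIterComm {X : Fin r → HNV r h m' ℓ → HNV r h m' ℓ}
    (hX : ∀ k, ContDiff ℝ (⊤ : ℕ∞) (X k)) {μ : ℕ} {Z : HNV r h m' ℓ → HNV r h m' ℓ}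
    (hZ : IsIterComm X μ Z) : Lowers X (fun _ => 1) 0 (-μ) Z := by
  induction hZ with
  | base k => exact lowers_word (by simp)
  | step k hZ ih =>
    refine Lowers.mono (Lowers.bracket hX (hX k) (contDiff_of_isIterComm hX hZ)
      (lowers_word (k := 1) (by simp)) ih) (by push_cast; omega)

lemma contDiff_Y (j : Fin h) (q : Fin (ℓ j)) : ContDiff ℝ (⊤ : ℕ∞) (S.Y j q) :=
  contDiff_of_isIterComm S.smoothX (S.Ycomm j q)

lemma contDiff_field (s) : ContDiff ℝ (⊤ : ℕ∞) (field S a s) := by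
  rcases s with q | s
  · exact S.smoothX q
  · exact (contDiff_coeff a s.1).smul (contDiff_Y S s.1 s.2)

lemma contDiff_leadX (k : Fin r) : ContDiff ℝ (⊤ : ℕ∞) (leadX S k) :=
  contDiff_const.add <| ContDiff.sum fun j _ => ContDiff.sum fun q _ =>
    (contDiff_of_isPolyFn (S.Ppoly k j q)).smul contDiff_const

lemma contDiff_coeffQ (k : Fin h) (j : Fin (ℓ k)) (τ : Fin h) (q : Fin (ℓ τ)) :
    ContDiff ℝ (⊤ : ℕ∞) fun x => if k < τ then S.Q k j τ q x else 0 := by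
  split_ifs
  · exact contDiff_of_isPolyFn (S.Qpoly k j τ q)
  · exact contDiff_const

lemma contDiff_leadY (k : Fin h) (j : Fin (ℓ k)) : ContDiff ℝ (⊤ : ℕ∞) (leadY S k j) :=
  contDiff_const.add <| ContDiff.sum fun τ _ => ContDiff.sum fun q _ =>
    (contDiff_coeffQ S k j τ q).smul contDiff_const

lemma contDiff_leadField (s) : ContDiff ℝ (⊤ : ℕ∞) (leadField S a s) := by
  rcases s with q | s
  · exact contDiff_leadX S q
  · exact (contDiff_coeff a s.1).smul (contDiff_leadY S s.1 s.2)

lemma hasOrd_coeff {I : Type*} {V : I → HNV r h m' ℓ → HNV r h m' ℓ} {w : I → ℕ∞}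
    (hV : ∀ i, ContDiff ℝ (⊤ : ℕ∞) (V i)) (hw : ∀ i, w i ≠ 0) (j : Fin h) :
    HasOrd V w 0 (mm j - 1 : ℕ) (coeff a mm j : HNV r h m' ℓ → ℝ) := by
  have h1 : HasOrd V w 0 1 (linForm a : HNV r h m' ℓ → ℝ) :=
    hasOrd_one hw (by simp [linForm])
  have h2 := HasOrd.smul hV (contDiff_const (c := (1 / (mm j : ℝ))))
    ((contDiff_linForm a).pow (mm j - 1)) (hasOrd_of_nonpos le_rfl _)
    (HasOrd.pow hV (contDiff_linForm a) h1 (mm j - 1))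
  exact h2.mono (by simp)

lemma hnwt_ne_zero (hmm : ∀ j, 1 < mm j) (i : HNIdx r h m' ℓ) : hnwt mm i ≠ 0 := by
  rcases i with (i | i) | i
  · simp [hnwt]
  · have := hmm i.1
    simp [hnwt]; omega
  · simp [hnwt]

lemma lowers_leadX (k : Fin r) : Lowers coordField (hnwt mm) 0 (-1) (leadX S k) := by
  have hs : ∀ j q, ContDiff ℝ (⊤ : ℕ∞)
      fun x => S.P k j q x • (hnb (Sum.inl (Sum.inr ⟨j, q⟩)) : HNV r h m' ℓ) := fun j q =>
    (contDiff_of_isPolyFn (S.Ppoly k j q)).smul contDiff_const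
  refine Lowers.add contDiff_coordField contDiff_const
    (ContDiff.sum fun j _ => ContDiff.sum fun q _ => hs j q)
    (lowers_word (V := coordField) (i := Sum.inl (Sum.inl k)) (k := 1) rfl) ?_
  refine Lowers.sum contDiff_coordField _ (fun j => ContDiff.sum fun q _ => hs j q)
    fun j _ => Lowers.sum contDiff_coordField _ (hs j) fun q _ => ?_
  have := S.one_lt j
  exact Lowers.smul_of_eq contDiff_coordField (contDiff_of_isPolyFn (S.Ppoly k j q))
    contDiff_const (hasOrd_of_wHomog (contDiff_of_isPolyFn (S.Ppoly k j q)) (S.Phomog k j q))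
    (lowers_word (V := coordField) (i := Sum.inl (Sum.inr ⟨j, q⟩)) (k := mm j) rfl)
    (by omega)

lemma lowers_leadY (k : Fin h) (j : Fin (ℓ k)) :
    Lowers coordField (hnwt mm) 0 (-(mm k : ℤ)) (leadY S k j) := by
  have hs : ∀ τ q, ContDiff ℝ (⊤ : ℕ∞) fun x => (if k < τ then S.Q k j τ q x else 0) •
      (hnb (Sum.inl (Sum.inr ⟨τ, q⟩)) : HNV r h m' ℓ) := fun τ q =>
    (contDiff_coeffQ S k j τ q).smul contDiff_const
  refine Lowers.add contDiff_coordField contDiff_const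
    (ContDiff.sum fun τ _ => ContDiff.sum fun q _ => hs τ q)
    (lowers_word (V := coordField) (i := Sum.inl (Sum.inr ⟨k, j⟩)) (k := mm k) rfl) ?_
  refine Lowers.sum contDiff_coordField _ (fun τ => ContDiff.sum fun q _ => hs τ q)
    fun τ _ => Lowers.sum contDiff_coordField _ (hs τ) fun q _ => ?_
  refine Lowers.smul_of_eq (d := (mm τ : ℤ) - mm k) contDiff_coordField
    (contDiff_coeffQ S k j τ q) contDiff_const ?_
    (lowers_word (V := coordField) (i := Sum.inl (Sum.inr ⟨τ, q⟩)) (k := mm τ) rfl) (by omega)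
  by_cases hkτ : k < τ
  · have := S.mono hkτ
    simp only [hkτ, if_true]
    exact (hasOrd_of_wHomog (contDiff_of_isPolyFn (S.Qpoly k j τ q)) (S.Qhomog k j τ q)).mono
      (by omega)
  · simp only [hkτ, if_false]
    exact hasOrd_zero_fun _

lemma lowers_leadField (s) : Lowers coordField (hnwt mm) 0 (-1) (leadField S a s) := by
  rcases s with q | s
  · exact lowers_leadX S q
  · have := S.one_lt s.1
    exact Lowers.smul_of_eq contDiff_coordField (contDiff_coeff (mm := mm) a s.1)
      (contDiff_leadY S s.1 s.2) (hasOrd_coeff a contDiff_coordField (hnwt_ne_zero S.one_lt) s.1)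
      (lowers_leadY S s.1 s.2) (by omega)

lemma lowers_field_sub (s) :
    Lowers coordField (hnwt mm) 0 0 (fun x => field S a s x - leadField S a s x) := by
  rcases s with q | s
  · exact lowers_of_vfBigOwt ((S.smoothX q).sub (contDiff_leadX S q)) (S.Xform q)
  · have := S.one_lt s.1
    have hs := (contDiff_Y S s.1 s.2).sub (contDiff_leadY S s.1 s.2)
    have := Lowers.smul_of_eq (b := 0) contDiff_coordField (contDiff_coeff (mm := mm) a s.1) hs
      (hasOrd_coeff a contDiff_coordField (hnwt_ne_zero S.one_lt) s.1)
      (lowers_of_vfBigOwt hs (S.Yform s.1 s.2)) (by omega)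
    simp only [smul_sub] at this
    exact this

lemma lowers_field (s) : Lowers coordField (hnwt mm) 0 (-1) (field S a s) := by
  have := Lowers.add contDiff_coordField
    ((contDiff_field S a s).sub (contDiff_leadField S a s)) (contDiff_leadField S a s)
    ((lowers_field_sub S a s).mono (by norm_num)) (lowers_leadField S a s)
  simpa using this

lemma lowers_field_words (s) : Lowers S.X (fun _ => 1) 0 (-1) (field S a s) := by
  rcases s with q | s
  · exact lowers_word (by simp)
  · have := S.one_lt s.1
    exact Lowers.smul_of_eq S.smoothX (contDiff_coeff (mm := mm) a s.1) (contDiff_Y S s.1 s.2)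
      (hasOrd_coeff (mm := mm) a S.smoothX (by simp) s.1)
      (lowers_of_isIterComm S.smoothX (S.Ycomm s.1 s.2)) (by omega)

/-- The scaling factors of the weighted dilation, with the `s′` directions collapsed. -/
def scale (mm : Fin h → ℕ) (τ : ℝ) : HNIdx r h m' ℓ → ℝ
  | .inl (.inl _) => τ
  | .inl (.inr s) => τ ^ mm s.1
  | .inr _ => 0

/-- The weighted dilation with the `s′` directions collapsed. -/
def dil (mm : Fin h → ℕ) (τ : ℝ) (c : HNV r h m' ℓ) : HNV r h m' ℓ := fun i => scale mm τ i * c i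

lemma scale_eq_pow (τ : ℝ) (i : HNIdx r h m' ℓ) (k : ℕ) (hk : hnwt mm i = (k : ℕ∞)) :
    scale mm τ i = τ ^ k := by
  rcases i with (i | i) | i
  · obtain rfl : 1 = k := by
      change (1 : ℕ∞) = k at hk
      exact_mod_cast hk
    simp [scale]
  · obtain rfl : mm i.1 = k := by simpa [hnwt] using hk
    rfl
  · simp [hnwt] at hk

lemma dil_eq_hndil (τ : ℝ) (c : HNV r h m' ℓ) : dil mm τ c = hndil mm τ (dil mm 1 c) := by
  ext i
  rcases i with (i | i) | i <;> simp [dil, scale, hndil]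

lemma linForm_dil (τ : ℝ) (c : HNV r h m' ℓ) :
    linForm a (dil mm τ c) = τ * linForm a c := by
  simp [linForm, dil, scale, Finset.mul_sum, mul_left_comm]

lemma dil_zero_left (hmm : ∀ j, 1 < mm j) (c : HNV r h m' ℓ) : dil mm 0 c = 0 := by
  ext i
  rcases i with (i | i) | i
  · simp [dil, scale]
  · have := hmm i.1
    simp [dil, scale, show mm i.1 ≠ 0 by omega]
  · simp [dil, scale]

lemma contDiff_dil : ContDiff ℝ (⊤ : ℕ∞) fun z : HNV r h m' ℓ × ℝ => dil mm z.2 z.1 := by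
  refine contDiff_pi.mpr fun i => ?_
  have hi : ContDiff ℝ (⊤ : ℕ∞) fun z : HNV r h m' ℓ × ℝ => z.1 i :=
    (contDiff_apply ℝ ℝ i).comp contDiff_fst
  rcases i with (i | i) | i
  · exact contDiff_snd.mul hi
  · exact (contDiff_snd.pow _).mul hi
  · exact contDiff_const.mul hi

lemma sum_smul_hnb (A : (Σ j : Fin h, Fin (ℓ j)) → ℝ) :
    (∑ j : Fin h, ∑ q : Fin (ℓ j),
      A ⟨j, q⟩ • (hnb (Sum.inl (Sum.inr ⟨j, q⟩)) : HNV r h m' ℓ)) =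
      fun i => match i with
        | .inl (.inr s) => A s
        | _ => 0 := by
  rw [← Fintype.sum_sigma (fun s : Σ j : Fin h, Fin (ℓ j) =>
    A s • (hnb (Sum.inl (Sum.inr s)) : HNV r h m' ℓ))]
  ext i
  rcases i with (i | i) | i <;> simp [hnb, Finset.sum_apply, Pi.single_apply]

lemma leadX_apply (k : Fin r) (x : HNV r h m' ℓ) : leadX S k x = fun i => match i with
    | .inl (.inl k') => if k' = k then 1 else 0
    | .inl (.inr s) => S.P k s.1 s.2 x
    | .inr _ => 0 := by
  rw [leadX, sum_smul_hnb fun s => S.P k s.1 s.2 x]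
  ext i
  rcases i with (i | i) | i <;> simp [hnb, Pi.single_apply]

lemma leadY_apply (s : Σ j : Fin h, Fin (ℓ j)) (x : HNV r h m' ℓ) :
    leadY S s.1 s.2 x = fun i => match i with
    | .inl (.inr s') => (if s' = s then 1 else 0) +
        if s.1 < s'.1 then S.Q s.1 s.2 s'.1 s'.2 x else 0
    | _ => 0 := by
  rw [leadY, sum_smul_hnb fun s' => if s.1 < s'.1 then S.Q s.1 s.2 s'.1 s'.2 x else 0]
  ext i
  rcases i with (i | i) | i <;> simp [hnb, Pi.single_apply]

/-- Every orbit of the dilations with `L ≠ 0` is an integral curve of the leading part of `Z`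
for suitable parameters. -/
lemma exists_hasDerivAt_dil (c : HNV r h m' ℓ) (hc : linForm a c ≠ 0) :
    ∃ t : (Fin r ⊕ (Σ j : Fin h, Fin (ℓ j))) → ℝ, ∀ τ,
      HasDerivAt (fun τ => dil mm τ c) (∑ s, t s • leadField S a s (dil mm τ c)) τ := by
  have hmm : ∀ j, mm j ≠ 0 := fun j => by have := S.one_lt j; omega
  obtain ⟨T, hT⟩ := exists_triangular_solution
    (fun s : Σ j : Fin h, Fin (ℓ j) => (s.1 : ℕ)) (fun s => coeff a mm s.1 c)
    (fun s => mm s.1 * c (.inl (.inr s)) -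
      ∑ k, c (.inl (.inl k)) * S.P k s.1 s.2 (dil mm 1 c))
    (fun s => mul_ne_zero (by simp [hmm]) (pow_ne_zero _ hc))
    (fun s' s => coeff a mm s'.1 c *
      if s'.1 < s.1 then S.Q s'.1 s'.2 s.1 s.2 (dil mm 1 c) else 0)
    (fun s' s hs => by
      have : ¬ s'.1 < s.1 := hs
      simp [this])
  refine ⟨Sum.elim (fun k => c (.inl (.inl k))) T, fun τ => hasDerivAt_pi.mpr fun i => ?_⟩
  have hval : (∑ s, (Sum.elim (fun k => c (.inl (.inl k))) T : _ → ℝ) s •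
      leadField S a s (dil mm τ c)) i =
      (∑ k, c (.inl (.inl k)) * leadX S k (dil mm τ c) i) +
      ∑ s : Σ j : Fin h, Fin (ℓ j),
        T s * (coeff a mm s.1 (dil mm τ c) * leadY S s.1 s.2 (dil mm τ c) i) := by
    simp [Fintype.sum_sum_type, leadField]
  rw [hval]
  simp only [leadX_apply, leadY_apply]
  rcases i with (i | s) | i
  · simpa [dil, scale] using (hasDerivAt_id τ).mul_const (c (.inl (.inl i)))
  · have hP : ∀ k, S.P k s.1 s.2 (dil mm τ c) =
        τ ^ (mm s.1 - 1) * S.P k s.1 s.2 (dil mm 1 c) := fun k => by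
      rw [dil_eq_hndil, S.Phomog]
    have hcoeff : ∀ j, coeff a mm j (dil mm τ c) = τ ^ (mm j - 1) * coeff a mm j c := fun j => by
      simp only [coeff, linForm_dil, mul_pow]; ring
    have hQ : ∀ s' : Σ j : Fin h, Fin (ℓ j), coeff a mm s'.1 (dil mm τ c) *
        ((if s = s' then 1 else 0) +
          if s'.1 < s.1 then S.Q s'.1 s'.2 s.1 s.2 (dil mm τ c) else 0) =
        τ ^ (mm s.1 - 1) * (coeff a mm s'.1 c * ((if s = s' then 1 else 0) +
          if s'.1 < s.1 then S.Q s'.1 s'.2 s.1 s.2 (dil mm 1 c) else 0)) := by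
      intro s'
      rw [hcoeff]
      by_cases hlt : s'.1 < s.1
      · have hne : s ≠ s' := by rintro rfl; exact lt_irrefl _ hlt
        have h1 := S.mono hlt
        have h2 := S.one_lt s'.1
        simp only [hlt, hne, if_true, if_false, zero_add]
        rw [dil_eq_hndil, S.Qhomog,
          show mm s.1 - 1 = (mm s'.1 - 1) + (mm s.1 - mm s'.1) by omega, pow_add]
        ring
      · by_cases hss : s = s'
        · subst hss; simp
        · simp [hlt, hss]
    simp only [hP, hQ]
    have hsol : (mm s.1 : ℝ) * c (.inl (.inr s)) =
        (∑ k, c (.inl (.inl k)) * S.P k s.1 s.2 (dil mm 1 c)) +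
        ∑ s' : Σ j : Fin h, Fin (ℓ j), T s' * (coeff a mm s'.1 c * ((if s = s' then 1 else 0) +
          if s'.1 < s.1 then S.Q s'.1 s'.2 s.1 s.2 (dil mm 1 c) else 0)) := by
      have := hT s
      simp only [mul_add, Finset.sum_add_distrib] at this ⊢
      simp only [mul_ite, mul_one, mul_zero, Finset.sum_ite_eq, Finset.mem_univ, if_true]
        at this ⊢
      linarith
    have hd := (hasDerivAt_pow (mm s.1) τ).mul_const (c (.inl (.inr s)))
    refine HasDerivAt.congr_deriv (f := fun τ => dil mm τ c (.inl (.inr s))) hd ?_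
    rw [show (mm s.1 : ℝ) * τ ^ (mm s.1 - 1) * c (.inl (.inr s)) =
      τ ^ (mm s.1 - 1) * (mm s.1 * c (.inl (.inr s))) by ring, hsol, mul_add, Finset.mul_sum,
      Finset.mul_sum]
    congr 1 <;> exact Finset.sum_congr rfl fun _ _ => by ring
  · simpa [dil, scale] using hasDerivAt_const τ (0 : ℝ)

lemma iterate_lieD_snd {f : HNV r h m' ℓ × ℝ → ℂ} (hf : ContDiff ℝ (⊤ : ℕ∞) f) (n : ℕ)
    (c : HNV r h m' ℓ) (τ : ℝ) :
    (lieD fun _ => ((0 : HNV r h m' ℓ), (1 : ℝ)))^[n] f (c, τ) =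
      deriv^[n] (fun σ => f (c, σ)) τ := by
  exact (congrFun (iterate_deriv_comp_curve (Z := fun _ => ((0 : HNV r h m' ℓ), (1 : ℝ)))
    contDiff_const (γ := fun τ => (c, τ))
    (fun τ => (hasDerivAt_const τ c).prodMk (hasDerivAt_id τ)) n hf) τ).symm

/-- The coordinate vector fields of the first factor. -/
def coordFst (i : HNIdx r h m' ℓ) : HNV r h m' ℓ × ℝ → HNV r h m' ℓ × ℝ := fun _ => (hnb i, 0)

lemma contDiff_coordFst (i : HNIdx r h m' ℓ) : ContDiff ℝ (⊤ : ℕ∞) (coordFst i) :=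
  contDiff_const

lemma words_coordFst (L : List (HNIdx r h m' ℓ)) {f : HNV r h m' ℓ × ℝ → ℂ}
    (hf : ContDiff ℝ (⊤ : ℕ∞) f) (c : HNV r h m' ℓ) (τ : ℝ) :
    words coordFst L f (c, τ) = words coordField L (fun x => f (x, τ)) c := by
  induction L generalizing f with
  | nil => rfl
  | cons i L ih =>
    change words coordFst L (lieD (coordFst i) f) (c, τ) =
      words coordField L (lieD (coordField i) fun x => f (x, τ)) c
    rw [ih ((contDiff_coordFst i).lieD hf)]
    congr 1
    ext x
    have h1 : HasFDerivAt (fun x => f (x, τ))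
        ((fderiv ℝ f (x, τ)).comp (ContinuousLinearMap.inl ℝ (HNV r h m' ℓ) ℝ)) x :=
      (differentiable hf (x, τ)).hasFDerivAt.comp x
        ((hasFDerivAt_id x).prodMk (hasFDerivAt_const τ x))
    simp [lieD, h1.fderiv, coordFst, coordField]

lemma words_iterate_comm (L : List (HNIdx r h m' ℓ)) (n : ℕ) {f : HNV r h m' ℓ × ℝ → ℂ}
    (hf : ContDiff ℝ (⊤ : ℕ∞) f) :
    words coordFst L ((lieD fun _ => ((0 : HNV r h m' ℓ), (1 : ℝ)))^[n] f) =
      (lieD fun _ => ((0 : HNV r h m' ℓ), (1 : ℝ)))^[n] (words coordFst L f) := by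
  have h1 : ∀ (i : HNIdx r h m' ℓ) (n : ℕ) {f : HNV r h m' ℓ × ℝ → ℂ},
      ContDiff ℝ (⊤ : ℕ∞) f →
      lieD (coordFst i) ((lieD fun _ => ((0 : HNV r h m' ℓ), (1 : ℝ)))^[n] f) =
        (lieD fun _ => ((0 : HNV r h m' ℓ), (1 : ℝ)))^[n] (lieD (coordFst i) f) := by
    intro i n
    induction n with
    | zero => intro f _; rfl
    | succ n ih =>
      intro f hf
      rw [Function.iterate_succ, Function.comp_apply, Function.comp_apply,
        ih (contDiff_const.lieD hf)]
      congr 1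
      exact lieD_const_comm _ _ hf
  induction L generalizing f with
  | nil => rfl
  | cons i L ih =>
    change words coordFst L (lieD (coordFst i) _) = _
    rw [h1 i n hf, ih ((contDiff_coordFst i).lieD hf)]
    rfl

/-- If the `d`-th derivatives at `0` along all orbits of the dilations vanish, so do the Taylor
coefficients of weight `d`. -/
lemma words_eq_zero_of_iterate_deriv_dil {f : HNV r h m' ℓ → ℂ}
    (hf : ContDiff ℝ (⊤ : ℕ∞) f) {d : ℕ}
    (hd : ∀ c, deriv^[d] (fun τ => f (dil mm τ c)) 0 = 0) (L : List (HNIdx r h m' ℓ))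
    (hL : (L.map (hnwt mm)).sum = (d : ℕ∞)) : words coordField L f 0 = 0 := by
  let G : HNV r h m' ℓ × ℝ → ℂ := fun z => f (dil mm z.2 z.1)
  let D : HNV r h m' ℓ × ℝ → HNV r h m' ℓ × ℝ := fun _ => (0, 1)
  have hG : ContDiff ℝ (⊤ : ℕ∞) G := hf.comp contDiff_dil
  have hDG : ContDiff ℝ (⊤ : ℕ∞) ((lieD D)^[d] G) := contDiff_iterate_lieD contDiff_const d hG
  have h0 : words coordFst L ((lieD D)^[d] G) (0, 0) = 0 := by
    rw [words_coordFst L hDG]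
    have : (fun x => (lieD D)^[d] G (x, 0)) = 0 := by
      ext x
      rw [iterate_lieD_snd hG d x 0]
      exact hd x
    rw [this, words_zero]
    rfl
  have hWG : ContDiff ℝ (⊤ : ℕ∞) (words coordFst L G) := contDiff_words contDiff_coordFst L hG
  have h1 : (fun σ => words coordFst L G (0, σ)) = fun σ => σ ^ d • words coordField L f 0 := by
    ext σ
    rw [words_coordFst L hG]
    have := congrFun (words_comp_diag (scale mm σ) L hf) 0
    simp only [prod_map_eq_pow (scale_eq_pow σ) L d hL, Pi.zero_apply, mul_zero] at this
    exact this
  rw [words_iterate_comm L d hG, iterate_lieD_snd hWG, h1, iterate_deriv_pow_smul] at h0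
  simpa [Nat.factorial_ne_zero] using h0

lemma iterate_deriv_dil_eq_zero (ha : a ≠ 0) {f : HNV r h m' ℓ → ℂ}
    (hf : ContDiff ℝ (⊤ : ℕ∞) f) {d : ℕ}
    (hd : ∀ c, linForm a c ≠ 0 → deriv^[d] (fun τ => f (dil mm τ c)) 0 = 0)
    (c : HNV r h m' ℓ) : deriv^[d] (fun τ => f (dil mm τ c)) 0 = 0 := by
  by_cases hc : linForm a c = 0
  · obtain ⟨k, hk⟩ := Function.ne_iff.mp ha
    let v : HNV r h m' ℓ := hnb (.inl (.inl k))
    have hlin : ∀ ε : ℝ, linForm a (c + ε • v) = ε * a k := by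
      intro ε
      have : linForm a (c + ε • v) = linForm a c + ε * a k := by
        simp [linForm, v, hnb, mul_add, Finset.sum_add_distrib, Pi.single_apply, mul_comm]
      rw [this, hc, zero_add]
    have hG : ContDiff ℝ (⊤ : ℕ∞) fun z : HNV r h m' ℓ × ℝ => f (dil mm z.2 z.1) :=
      hf.comp contDiff_dil
    have hcont : Continuous fun ε : ℝ =>
        deriv^[d] (fun τ => f (dil mm τ (c + ε • v))) 0 := by
      simp only [← iterate_lieD_snd hG d _ 0]
      exact (contDiff_iterate_lieD contDiff_const d hG).continuous.comp (by fun_prop)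
    have := Continuous.ext_on (dense_compl_singleton (0 : ℝ)) hcont continuous_const
      fun ε hε => hd _ (by rw [hlin]; exact mul_ne_zero hε hk)
    simpa using congrFun this 0
  · exact hd c hc

/-- A function of exact weighted order `d` has `Z^d f(0) ≠ 0` for some parameter. -/
lemma exists_iterate_ne_zero (ha : a ≠ 0) {f : HNV r h m' ℓ → ℂ}
    (hf : ContDiff ℝ (⊤ : ℕ∞) f) {d : ℕ} (hfd : HasOrd coordField (hnwt mm) 0 d f)
    (hfd' : ¬ HasOrd coordField (hnwt mm) 0 (d + 1) f) :
    ∃ t : (Fin r ⊕ (Σ j : Fin h, Fin (ℓ j))) → ℝ, (lieD fun p => ∑ s, t s • field S a s p)^[d] f 0 ≠ 0 := by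
  by_contra! hcon
  refine hfd' fun L n hn hlt => ?_
  rcases (by omega : n < d ∨ n = d) with h | rfl
  · exact hfd L n hn (by exact_mod_cast h)
  refine words_eq_zero_of_iterate_deriv_dil hf
    (iterate_deriv_dil_eq_zero a ha hf fun c hc => ?_) L hn
  obtain ⟨t, ht⟩ := exists_hasDerivAt_dil S a c hc
  have hs := contDiff_field S a
  have hs₀ := contDiff_leadField S a
  have hZ₀ : ContDiff ℝ (⊤ : ℕ∞) fun p => ∑ s, t s • leadField S a s p :=
    contDiff_linear_comb t hs₀
  have hR : Lowers coordField (hnwt mm) 0 0 (fun p =>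
      ∑ s, t s • field S a s p - ∑ s, t s • leadField S a s p) := by
    have := Lowers.linear_comb contDiff_coordField (fun s => (hs s).sub (hs₀ s))
      (lowers_field_sub S a) t
    simpa only [smul_sub, Finset.sum_sub_distrib] using this
  rw [iterate_deriv_comp_curve hZ₀ ht n hf]
  simp only [dil_zero_left S.one_lt]
  rw [← hcon t]
  refine (iterate_lieD_eq contDiff_coordField
    (contDiff_linear_comb t hs) hZ₀
    (Lowers.linear_comb contDiff_coordField hs (lowers_field S a) t)
    (Lowers.linear_comb contDiff_coordField hs₀ (lowers_leadField S a) t) hR n hf hf hfd ?_).symm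
  rw [sub_self]
  exact hasOrd_zero_fun _

lemma inModule_X (k : Fin r) : InModuleHN S.X (S.X k) :=
  ⟨fun j _ => if j = k then 1 else 0, fun _ => contDiff_const, fun x => by simp⟩

lemma lowers_of_inModule {Y : HNV r h m' ℓ → HNV r h m' ℓ} (hY : InModuleHN S.X Y) :
    ContDiff ℝ (⊤ : ℕ∞) Y ∧ Lowers coordField (hnwt mm) 0 (-1) Y := by
  obtain ⟨b, hb, hYb⟩ := hY
  obtain rfl : Y = fun x => ∑ k, b k x • S.X k x := funext hYb
  refine ⟨ContDiff.sum fun k _ => (hb k).smul (S.smoothX k), Lowers.sum contDiff_coordField _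
    (fun k => (hb k).smul (S.smoothX k)) fun k _ => ?_⟩
  exact Lowers.smul_of_eq contDiff_coordField (hb k) (S.smoothX k)
    (hasOrd_of_nonpos le_rfl _) (lowers_field S 0 (.inl k)) (by norm_num)

lemma le_vanishOrderHN {f : HNV r h m' ℓ → ℂ} (hf : ContDiff ℝ (⊤ : ℕ∞) f) {d : ℕ}
    (hfd : HasOrd coordField (hnwt mm) 0 d f) : (d : ℕ∞) ≤ vanishOrderHN S.X f 0 := by
  refine le_sInf ?_
  rintro _ ⟨Ys, rfl, hmem, hne⟩
  by_contra! hlt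
  refine hne ?_
  clear hne
  have hlt' : (Ys.length : ℤ) < d := by exact_mod_cast hlt
  clear hlt
  generalize (d : ℤ) = e at hfd hlt'
  induction Ys generalizing f e with
  | nil => exact hfd.apply_eq_zero (by simpa using hlt')
  | cons Y Ys ih =>
    obtain ⟨hYs, hYl⟩ := lowers_of_inModule S (hmem Y (by simp))
    refine ih (f := lieD Y f) (hYs.lieD hf) (fun Y' h' => hmem Y' (by simp [h'])) _
      (hYl _ _ hf hfd) ?_
    simp only [List.length_cons] at hlt'
    push_cast at hlt'
    omega

lemma contDiff_zField (t : (Fin r ⊕ (Σ j : Fin h, Fin (ℓ j))) → ℝ) : ContDiff ℝ (⊤ : ℕ∞) (ZField S a t) := by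
  rw [zField_eq]
  exact contDiff_linear_comb t (contDiff_field S a)

/-- The inequality `ν_𝒟(f)(0) ≤ ν_Z(f)(0)`, valid for all parameters. -/
lemma vanishOrderHN_le_nuZ (t : (Fin r ⊕ (Σ j : Fin h, Fin (ℓ j))) → ℝ) {f : HNV r h m' ℓ → ℂ} (hf : ContDiff ℝ (⊤ : ℕ∞) f) :
    vanishOrderHN S.X f 0 ≤ nuZ (ZField S a t) f 0 := by
  refine le_sInf ?_
  rintro _ ⟨k, rfl, hk⟩
  by_contra! hlt
  have hord : HasOrd S.X (fun _ => 1) 0 (k + 1) f := by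
    intro L n hn hnk
    by_contra hL
    have hLn : L.length = n := by simpa using hn
    have : vanishOrderHN S.X f 0 ≤ L.length := by
      refine sInf_le ⟨L.map S.X, by simp, ?_, ?_⟩
      · simp only [List.mem_map]
        rintro _ ⟨j, _, rfl⟩
        exact inModule_X S j
      · rw [List.foldl_map]
        exact hL
    have h2 := hlt.trans_le this
    rw [hLn] at h2
    have : k < n := by exact_mod_cast h2
    omega
  refine hk (HasOrd.apply_eq_zero (V := S.X) (w := fun _ => 1) (d := k + 1 - k) (by omega) ?_)
  refine Lowers.iterate (contDiff_zField S a t) ?_ k hf hord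
  rw [zField_eq]
  exact Lowers.linear_comb S.smoothX (contDiff_field S a) (lowers_field_words S a) t

end Setting

end HNOrder

/-- Theorem 2.4. In the Helffer–Nourrigat normalized setting, for any
nonzero linear function `L(x) = Σ_k a_k x_k` and any germ `f` of a smooth function at `0`,
for a generic choice of the parameters `t` — namely all `t` outside the zero set of some
nonzero real-analytic function on the parameter space `ℝ^{n₀}` — one has
`ν_𝒟(f)(0) = ν_Z(f)(0)`. -/
theorem vanishOrder_eq_nuZ {r h m' : ℕ} {ℓ : Fin h → ℕ} {mm : Fin h → ℕ}
    (S : HNSetting r h m' ℓ mm) (a : Fin r → ℝ) (ha : a ≠ 0)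
    (f : HNV r h m' ℓ → ℂ) (hf : ContDiff ℝ (⊤ : ℕ∞) f) :
    ∃ φ : ((Fin r ⊕ (Σ j : Fin h, Fin (ℓ j))) → ℝ) → ℝ,
      AnalyticOnNhd ℝ φ Set.univ ∧ φ ≠ 0 ∧
      ∀ t : (Fin r ⊕ (Σ j : Fin h, Fin (ℓ j))) → ℝ, φ t ≠ 0 →
        vanishOrderHN S.X f 0 = nuZ (ZField S a t) f 0 := by
  by_cases hall : ∀ d : ℕ, HNOrder.HasOrd HNOrder.coordField (hnwt mm) 0 d f
  · refine ⟨fun _ => 1, analyticOnNhd_const, one_ne_zero, fun t _ => ?_⟩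
    have htop : vanishOrderHN S.X f 0 = ⊤ :=
      ENat.eq_top_iff_forall_ge.mpr fun d => HNOrder.le_vanishOrderHN S hf (hall d)
    exact le_antisymm (HNOrder.vanishOrderHN_le_nuZ S a t hf) (htop ▸ le_top)
  · push Not at hall
    obtain ⟨d, hd, hd'⟩ : ∃ d : ℕ, HNOrder.HasOrd HNOrder.coordField (hnwt mm) 0 d f ∧
        ¬ HNOrder.HasOrd HNOrder.coordField (hnwt mm) 0 (d + 1) f := by
      by_contra! hcon
      obtain ⟨d, hd⟩ := hall
      refine hd ?_
      clear hd
      induction d with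
      | zero => exact HNOrder.hasOrd_of_nonpos (by simp) f
      | succ d ih => exact_mod_cast hcon d ih
    obtain ⟨t₀, ht₀⟩ := HNOrder.exists_iterate_ne_zero S a ha hf hd hd'
    have han := HNOrder.analyticOnNhd_iterate_lieD (HNOrder.contDiff_field S a) d hf 0
    refine ⟨fun t => ‖(HNOrder.lieD fun p => ∑ s, t s • HNOrder.field S a s p)^[d] f 0‖ ^ 2,
      ?_, fun h0 => ht₀ (by simpa using congrFun h0 t₀), fun t ht => ?_⟩
    · have hre := (Complex.reCLM.analyticOnNhd Set.univ).comp han (Set.mapsTo_univ _ _)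
      have him := (Complex.imCLM.analyticOnNhd Set.univ).comp han (Set.mapsTo_univ _ _)
      refine ((hre.mul hre).add (him.mul him)).congr isOpen_univ fun t _ => ?_
      simp [Complex.sq_norm, Complex.normSq_apply]
    · refine le_antisymm (HNOrder.vanishOrderHN_le_nuZ S a t hf) ?_
      refine le_trans (sInf_le ⟨d, rfl, ?_⟩) (HNOrder.le_vanishOrderHN S hf hd)
      rw [HNOrder.zField_eq]
      exact fun h0 => ht (by
        change (HNOrder.lieD fun p => ∑ s, t s • HNOrder.field S a s p)^[d] f 0 = 0 at h0
        simp only [h0, norm_zero, ne_eq, OfNat.ofNat_ne_zero, not_false_eq_true, zero_pow])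
end
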